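/- For all m ≥ 1, n ≥ 1, k ≥ 0 and 1 ≤ s ≤ n+1, one has Tqt★(n,m;s;k) = RPqt•(m,n;s;k) in ℤ[q,t]: the (dinv, underlined-area) q,t-enumerator of two-cars parking functions of size m+n with m labels 1, n labels 2, exactly s−1 labels 2 on the main diagonal and k decorated rises equals the (area, underlined-bounce) q,t-enumerator of m×n reduced parallelogram polyominoes with k decorated red valleys whose bounce path carries exactly s−1 labels equal to 0. -/

import Mathlib

open Finset

/- ## Reduced parallelogram polyominoes

Letters of the ordered alphabet `0 < 0̄ < 1 < 1̄ < 2 < 2̄ < ⋯` are encoded as natural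
numbers: the letter with numeric value `v` is encoded as `2*v` if unbarred and as
`2*v+1` if barred.  With this encoding the order of the alphabet is the order of `ℕ`,
the successor in the alphabet is `+1`, the numeric value of a letter `c` is `c / 2`,
and a letter is barred iff `c % 2 = 1`. -/

/-- A reduced parallelogram polyomino of size `m × n`: a pair of `{0,1}`-sequences
(`true` = north step, `false` = east step) of length `m+n`, each with `n` north steps,
the red path staying weakly above the green one. -/
structure RedPoly (m n : ℕ) where
  red : Fin (m + n) → Bool
  green : Fin (m + n) → Bool
  red_count : (univ.filter fun i => red i = true).card = n
  green_count : (univ.filter fun i => green i = true).card = n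
  green_le_red : ∀ i : Fin (m + n),
    (univ.filter fun j => j ≤ i ∧ green j = true).card ≤
    (univ.filter fun j => j ≤ i ∧ red j = true).card

/-- Number of `true` entries strictly before position `j`. -/
def truesBefore {N : ℕ} (p : Fin N → Bool) (j : Fin N) : ℕ :=
  (univ.filter fun l => l < j ∧ p l = true).card

/-- Number of `false` entries strictly before position `j`. -/
def falsesBefore {N : ℕ} (p : Fin N → Bool) (j : Fin N) : ℕ :=
  (univ.filter fun l => l < j ∧ p l = false).card

/-- The height of the lattice path `p` over the column `[x, x+1]`, i.e. the number of
north steps occurring before the `(x+1)`-st east step. -/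
def heightAt {N : ℕ} (p : Fin N → Bool) (x : ℕ) : ℕ :=
  (univ.filter fun j => p j = true ∧ falsesBefore p j ≤ x).card

/-- The `x`-coordinate at which the lattice path `p` makes its north step from height
`y` to height `y+1`, i.e. the number of east steps occurring before the `(y+1)`-st
north step. -/
def xcoordAt {N : ℕ} (p : Fin N → Bool) (y : ℕ) : ℕ :=
  (univ.filter fun j => p j = false ∧ truesBefore p j ≤ y).card

/-- Reading a sequence of northeast (`true`) / southeast (`false`) steps starting at
height `h`, record for each northeast step the (encoded) letter of the level at which
it ends: a northeast step from height `h` to `h+1` ends at level `h+1`, whose letter is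
the `(h+1)`-st letter of the alphabet, encoded as `h`. -/
def areaWordAux : ℕ → List Bool → List ℕ
  | _, [] => []
  | h, true :: rest => h :: areaWordAux (h + 1) rest
  | h, false :: rest => areaWordAux (h - 1) rest

/-- The interlaced Dyck path `D = (1, r₁, 1-g₁, r₂, 1-g₂, …, r_{m+n}, 1-g_{m+n}, 0)`. -/
def interlaced {m n : ℕ} (P : RedPoly m n) : List Bool :=
  true :: ((List.ofFn fun i : Fin (m + n) => [P.red i, !P.green i]).flatten ++ [false])

/-- The area word of a reduced parallelogram polyomino (letters encoded in `ℕ`). -/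
def areaWord {m n : ℕ} (P : RedPoly m n) : List ℕ :=
  areaWordAux 0 (interlaced P)

/-- `area`: the sum of the numeric values of the letters of the area word. -/
def areaStat {m n : ℕ} (P : RedPoly m n) : ℕ :=
  ((areaWord P).map fun c => c / 2).sum

/-- `dinv`: the number of pairs of positions `i < j` in the area word such that the
letter in position `i` is the successor (in the alphabet) of the letter in position `j`. -/
def dinvStat {m n : ℕ} (P : RedPoly m n) : ℕ :=
  ((Finset.range (areaWord P).length ×ˢ Finset.range (areaWord P).length).filter
    fun p => p.1 < p.2 ∧ (areaWord P).getD p.1 0 = (areaWord P).getD p.2 0 + 1).card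

/-- `d` is the position of the unbarred letter of a rise of the word `w`: the letter at
position `d-1` is barred and the letter at position `d` is its successor in the
alphabet. -/
def IsRise (w : List ℕ) (d : ℕ) : Prop :=
  0 < d ∧ d < w.length ∧ w.getD (d - 1) 0 % 2 = 1 ∧ w.getD d 0 = w.getD (d - 1) 0 + 1

/-- An `m × n` reduced parallelogram polyomino with `k` decorated rises (the marks
record the positions of the unbarred letters of the marked rises in the area word). -/
structure RiseDecorated (m n k : ℕ) where
  poly : RedPoly m n
  marks : Finset ℕ
  marks_card : marks.card = k
  marks_rise : ∀ d ∈ marks, IsRise (areaWord poly) d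

/-- `underlined-area`: the sum of the numeric values of the letters of the area word,
the marked letters excepted. -/
def uArea {m n k : ℕ} (Q : RiseDecorated m n k) : ℕ :=
  ∑ i ∈ Finset.range (areaWord Q.poly).length \ Q.marks, (areaWord Q.poly).getD i 0 / 2

/-- The corner points of the bounce path: `bouncePt P k = (X k, Y k)` where the
`(k+1)`-st vertical run goes from height `Y k` up to `Y (k+1)` (the height at which the
red path makes its east step over the current column), and the `(k+1)`-st horizontal
run goes from `X k` to `X (k+1)` (the `x`-coordinate at which the green path makes its
north step from the current height). -/
def bouncePt {m n : ℕ} (P : RedPoly m n) : ℕ → ℕ × ℕ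
  | 0 => (0, 0)
  | k + 1 =>
    (xcoordAt P.green (heightAt P.red (bouncePt P k).1),
     heightAt P.red (bouncePt P k).1)

/-- The numeric value of the label of the vertical step of the bounce path in row `y`
(the vertical steps of the `(k+1)`-st vertical run carry the unbarred letter `k`). -/
def vertLabel {m n : ℕ} (P : RedPoly m n) (y : ℕ) : ℕ :=
  ((Finset.range (m + n)).filter fun k => (bouncePt P (k + 1)).2 ≤ y).card

/-- The numeric value of the label of the horizontal step of the bounce path in column
`x` (the horizontal steps of the `(k+1)`-st horizontal run carry the barred letter `k̄`). -/
def horLabel {m n : ℕ} (P : RedPoly m n) (x : ℕ) : ℕ :=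
  ((Finset.range (m + n)).filter fun k => (bouncePt P (k + 1)).1 ≤ x).card

/-- `bounce`: the sum of the numeric values of the labels of the bounce path. -/
def bounceStat {m n : ℕ} (P : RedPoly m n) : ℕ :=
  (∑ y ∈ Finset.range n, vertLabel P y) + ∑ x ∈ Finset.range m, horLabel P x

/-- The number of labels of the bounce path equal to the (unbarred) letter `0`. -/
def zeroLabelCount {m n : ℕ} (P : RedPoly m n) : ℕ :=
  ((Finset.range n).filter fun y => vertLabel P y = 0).card

/-- A red valley: a north step of the red path preceded by an east step. -/
def IsRedValley {m n : ℕ} (P : RedPoly m n) (j : Fin (m + n)) : Prop :=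
  P.red j = true ∧ ∃ i : Fin (m + n), (i : ℕ) + 1 = (j : ℕ) ∧ P.red i = false

/-- The row (counted from `0`) occupied by the north step `j` of the red path. -/
def rowOf {m n : ℕ} (P : RedPoly m n) (j : Fin (m + n)) : ℕ :=
  truesBefore P.red j

/-- An `m × n` reduced parallelogram polyomino with `k` decorated red valleys. -/
structure ValleyDecorated (m n k : ℕ) where
  poly : RedPoly m n
  marks : Finset (Fin (m + n))
  marks_card : marks.card = k
  marks_valley : ∀ j ∈ marks, IsRedValley poly j

/-- `underlined-bounce`: the sum of the numeric values of the labels of the bounce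
path, excluding the labels of the bounce-path steps lying in the same row as a marked
valley. -/
def uBounce {m n k : ℕ} (Q : ValleyDecorated m n k) : ℕ :=
  (∑ y ∈ Finset.range n \ Q.marks.image (rowOf Q.poly), vertLabel Q.poly y) +
    ∑ x ∈ Finset.range m, horLabel Q.poly x

/- ## q,t-enumerators -/

/-- `q`, as an element of `ℤ[q,t] = MvPolynomial (Fin 2) ℤ`. -/
noncomputable def Xq : MvPolynomial (Fin 2) ℤ := MvPolynomial.X 0

/-- `t`, as an element of `ℤ[q,t] = MvPolynomial (Fin 2) ℤ`. -/
noncomputable def Xt : MvPolynomial (Fin 2) ℤ := MvPolynomial.X 1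

/-- The Gaussian `q`-binomial coefficient `[a choose b]_x`, defined by the `q`-Pascal
recursion `[a+1 choose b+1] = [a choose b] + x^(b+1) * [a choose b+1]`. -/
def qbinom {R : Type*} [CommSemiring R] (x : R) : ℕ → ℕ → R
  | _, 0 => 1
  | 0, _ + 1 => 0
  | a + 1, b + 1 => qbinom x a b + x ^ (b + 1) * qbinom x a (b + 1)

/-- `RPqt•(m,n;s;k)`: the `(area, underlined-bounce)` `q,t`-enumerator of `m × n`
reduced polyominoes with `k` decorated red valleys whose bounce path carries exactly
`s-1` labels equal to the letter `0`. -/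
noncomputable def RPbullet (m n s k : ℕ) : MvPolynomial (Fin 2) ℤ :=
  ∑ᶠ Q : ValleyDecorated m n k,
    if zeroLabelCount Q.poly + 1 = s then Xq ^ areaStat Q.poly * Xt ^ uBounce Q else 0

/-- `RPqt★(a,b;s;k)`: the `(dinv, underlined-area)` `q,t`-enumerator of `a × b` reduced
polyominoes with `k` decorated rises whose area word contains exactly `s` letters equal
to the unbarred letter `0`. -/
noncomputable def RPstar (a b s k : ℕ) : MvPolynomial (Fin 2) ℤ :=
  ∑ᶠ Q : RiseDecorated a b k,
    if (areaWord Q.poly).count 0 = s then Xq ^ dinvStat Q.poly * Xt ^ uArea Q else 0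

/- ## Two cars parking functions -/

/-- A two-cars parking function of size `N`, encoded by its area word `a` and its
labels `l`: `a` is the area word of a Dyck path (`a₀ = 0` and `a` increases by at most
`1` at each step), the labels are `1` or `2` and strictly increase bottom to top within
each column (two consecutive north steps lie in the same column exactly when the area
word increases by `1`). -/
structure TwoCarsPF (N : ℕ) where
  a : Fin N → ℕ
  l : Fin N → ℕ
  a_first : ∀ i : Fin N, (i : ℕ) = 0 → a i = 0
  a_step : ∀ i j : Fin N, (i : ℕ) + 1 = (j : ℕ) → a j ≤ a i + 1
  col_incr : ∀ i j : Fin N, (i : ℕ) + 1 = (j : ℕ) → a j = a i + 1 → l i < l j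
  l_one_le : ∀ i, 1 ≤ l i
  l_le_two : ∀ i, l i ≤ 2

/-- `dinv` of a (two-cars) parking function. -/
def pfDinv {N : ℕ} (F : TwoCarsPF N) : ℕ :=
  (univ.filter fun p : Fin N × Fin N =>
    p.1 < p.2 ∧ ((F.a p.1 = F.a p.2 ∧ F.l p.1 < F.l p.2) ∨
      (F.a p.1 = F.a p.2 + 1 ∧ F.l p.2 < F.l p.1))).card

/-- A rise of a parking function: an index whose area word entry is one more than the
previous one. -/
def IsPFRise {N : ℕ} (F : TwoCarsPF N) (i : Fin N) : Prop :=
  ∃ j : Fin N, (j : ℕ) + 1 = (i : ℕ) ∧ F.a i = F.a j + 1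

/-- A two-cars parking function of size `m+n` with `n` labels equal to `1`, `m` labels
equal to `2`, and `k` decorated rises. -/
structure DecTwoCarsPF (m n k : ℕ) where
  pf : TwoCarsPF (m + n)
  ones_count : (univ.filter fun i => pf.l i = 1).card = n
  twos_count : (univ.filter fun i => pf.l i = 2).card = m
  marks : Finset (Fin (m + n))
  marks_card : marks.card = k
  marks_rise : ∀ i ∈ marks, IsPFRise pf i

/-- `underlined-area` of a decorated parking function: the sum of the area word entries
over the non-marked indices. -/
def pfUArea {m n k : ℕ} (F : DecTwoCarsPF m n k) : ℕ :=
  ∑ i ∈ univ \ F.marks, F.pf.a i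

/-- The number of labels equal to `2` lying on the main diagonal. -/
def diagTwos {N : ℕ} (F : TwoCarsPF N) : ℕ :=
  (univ.filter fun i => F.a i = 0 ∧ F.l i = 2).card

/-- `Tqt★(a,b;s;k)`: the `(dinv, underlined-area)` `q,t`-enumerator of two-cars parking
functions of size `a+b` with `b` labels equal to `1`, `a` labels equal to `2`, exactly
`s-1` labels equal to `2` on the main diagonal, and `k` decorated rises. -/
noncomputable def Tstar (a b s k : ℕ) : MvPolynomial (Fin 2) ℤ :=
  ∑ᶠ F : DecTwoCarsPF a b k,
    if diagTwos F.pf + 1 = s then Xq ^ pfDinv F.pf * Xt ^ pfUArea F else 0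

/- ## Partially labelled Dyck paths (all rises decorated, all valleys blank) -/

/-- A valley of a Dyck path (in terms of its area word): a north step preceded by an
east step. -/
def IsValleyW {N : ℕ} (a : Fin N → ℕ) (i : Fin N) : Prop :=
  ∃ j : Fin N, (j : ℕ) + 1 = (i : ℕ) ∧ a i ≤ a j

/-- A rise of a Dyck path (in terms of its area word): a north step preceded by a north
step. -/
def IsRiseW {N : ℕ} (a : Fin N → ℕ) (i : Fin N) : Prop :=
  ∃ j : Fin N, (j : ℕ) + 1 = (i : ℕ) ∧ a i = a j + 1

instance {N : ℕ} (a : Fin N → ℕ) : DecidablePred (IsValleyW a) := fun i =>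
  inferInstanceAs (Decidable (∃ j : Fin N, (j : ℕ) + 1 = (i : ℕ) ∧ a i ≤ a j))

instance {N : ℕ} (a : Fin N → ℕ) : DecidablePred (IsRiseW a) := fun i =>
  inferInstanceAs (Decidable (∃ j : Fin N, (j : ℕ) + 1 = (i : ℕ) ∧ a i = a j + 1))

/-- An element of `PLDP(m,n)^{★n}`: a partially labelled Dyck path of size `m+n+1`
(encoded by the area word `a` of the Dyck path and the labels `l` of its north steps,
with `0` denoting a blank) with `n+1` positive labels and `m` blanks, in which every
valley is a blank, every blank is a valley, labels strictly increase bottom to top in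
each column, and every rise is decorated. -/
structure PLDPall (m n : ℕ) where
  a : Fin (m + n + 1) → ℕ
  l : Fin (m + n + 1) → ℕ
  a_first : ∀ i : Fin (m + n + 1), (i : ℕ) = 0 → a i = 0
  a_step : ∀ i j : Fin (m + n + 1), (i : ℕ) + 1 = (j : ℕ) → a j ≤ a i + 1
  col_incr : ∀ i j : Fin (m + n + 1), (i : ℕ) + 1 = (j : ℕ) → a j = a i + 1 → l i < l j
  blank_iff_valley : ∀ i, l i = 0 ↔ IsValleyW a i
  blank_count : (univ.filter fun i => l i = 0).card = m

/-- `underlined-area` of an element of `PLDP(m,n)^{★n}`: the sum of the area word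
entries over the north steps that are not (decorated) rises. -/
def pldpUArea {m n : ℕ} (D : PLDPall m n) : ℕ :=
  ∑ i ∈ univ.filter (fun i => ¬ IsRiseW D.a i), D.a i

/-- A labelled reduced polyomino of size `m × n`: an `m × n` reduced parallelogram
polyomino together with `n+1` positive integer labels, one below the first column
(index `0`) and one on each north step of the red path (the north step with `j` north
steps before it getting the label of index `j+1`), such that labels strictly increase
bottom to top within each column (the label below the first column being treated as an
artificial north step at the very beginning of the red path). -/
structure LabelledRP (m n : ℕ) where
  poly : RedPoly m n
  lab : Fin (n + 1) → ℕ
  lab_pos : ∀ j, 1 ≤ lab j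
  col_incr : ∀ p : Fin (m + n), poly.red p = true →
    ((p : ℕ) = 0 ∨ ∃ q : Fin (m + n), (q : ℕ) + 1 = (p : ℕ) ∧ poly.red q = true) →
    ∀ h : truesBefore poly.red p + 1 < n + 1,
      lab ⟨truesBefore poly.red p, Nat.lt_of_succ_lt h⟩ <
      lab ⟨truesBefore poly.red p + 1, h⟩

/-! ## Words -/

/-- The word `w` may follow the letter `x`: every letter exceeds the preceding one by at
most `1`. -/
def Climbs : ℕ → List ℕ → Prop
  | _, [] => True
  | x, y :: w => y ≤ x + 1 ∧ Climbs y w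

/-- The subword of `w` on the letters `i` and `i+1`, with `i` read as `true` and `i+1` as
`false`. -/
def layer (i : ℕ) : List ℕ → List Bool
  | [] => []
  | x :: w =>
    if x = i then true :: layer i w
    else if x = i + 1 then false :: layer i w else layer i w

/-- The layers `i, i+1, …, i+N-1` of a word. -/
def layers : ℕ → ℕ → List ℕ → List (List Bool)
  | 0, _, _ => []
  | N + 1, i, w => layer i w :: layers N (i + 1) w

theorem count_true_layer (i : ℕ) (w : List ℕ) : (layer i w).count true = w.count i := by
  induction w with
  | nil => rfl
  | cons x w ih =>
    simp only [layer, List.count_cons]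
    split_ifs <;> simp_all

theorem count_false_layer (i : ℕ) (w : List ℕ) :
    (layer i w).count false = w.count (i + 1) := by
  induction w with
  | nil => rfl
  | cons x w ih =>
    simp only [layer, List.count_cons]
    split_ifs <;> simp_all

theorem layer_eq_nil {i : ℕ} {w : List ℕ} (h : ∀ x ∈ w, x < i) : layer i w = [] := by
  induction w with
  | nil => rfl
  | cons x w ih =>
    have := h x (by simp)
    rw [layer, if_neg (by omega), if_neg (by omega), ih fun y hy => h y (by simp [hy])]

theorem length_layers (N i : ℕ) (w : List ℕ) : (layers N i w).length = N := by
  induction N generalizing i with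
  | zero => rfl
  | succ N ih => simp [layers, ih]

theorem layers_congr {i i' : ℕ} {w w' : List ℕ}
    (h : ∀ j, layer (i + j) w = layer (i' + j) w') (N : ℕ) :
    layers N i w = layers N i' w' := by
  induction N generalizing i i' with
  | zero => rfl
  | succ N ih =>
    have h0 := h 0
    simp only [add_zero] at h0
    rw [layers, layers, h0, ih fun j => ?_]
    rw [add_assoc, add_assoc, h]

theorem layer_eq_of_layers_eq {N i : ℕ} {w w' : List ℕ}
    (h : layers N i w = layers N i w') {j : ℕ} (hj : j < N) :
    layer (i + j) w = layer (i + j) w' := by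
  induction N generalizing i j with
  | zero => omega
  | succ N ih =>
    simp only [layers, List.cons.injEq] at h
    cases j with
    | zero => exact h.1
    | succ j =>
      have := ih h.2 (j := j) (by omega)
      rwa [show i + (j + 1) = i + 1 + j by omega]

theorem Climbs.lt_length {x : ℕ} {w : List ℕ} (h : Climbs x w) :
    ∀ y ∈ w, y ≤ x + w.length := by
  induction w generalizing x with
  | nil => simp
  | cons z w ih =>
    intro y hy
    have h1 := h.1
    rcases List.mem_cons.1 hy with rfl | hy
    · simp; omega
    · have := ih h.2 y hy
      simp; omega

theorem Climbs.head?_layer {x i : ℕ} {w : List ℕ} (h : Climbs x w) (hx : x < i) :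
    (layer i w).head? ≠ some false := by
  induction w generalizing x with
  | nil => simp [layer]
  | cons y w ih =>
    have h1 := h.1
    rw [layer]
    split_ifs with h2 h3
    · simp
    · omega
    · exact ih h.2 (by omega)

theorem Climbs.head_not_lt {y y' : ℕ} {w w' : List ℕ} (h : Climbs y w)
    (hl : ∀ i, layer i (y :: w) = layer i (y' :: w')) : ¬ y < y' := by
  intro hlt
  have h1 := hl (y' - 1)
  have h2 : layer (y' - 1) (y' :: w') = false :: layer (y' - 1) w' := by
    rw [layer, if_neg (by omega), if_pos (by omega)]
  rw [h2, layer] at h1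
  split_ifs at h1 with h3 h4
  · simp at h1
  · omega
  · exact h.head?_layer (i := y' - 1) (by omega) (by simp [h1])

theorem Climbs.eq_of_layer_eq {x x' : ℕ} {w w' : List ℕ} (h : Climbs x w)
    (h' : Climbs x' w') (hl : ∀ i, layer i w = layer i w') : w = w' := by
  induction w generalizing x x' w' with
  | nil =>
    cases w' with
    | nil => rfl
    | cons y' w' => simpa [layer] using hl y'
  | cons y w ih =>
    cases w' with
    | nil => simpa [layer] using hl y
    | cons y' w' =>
      obtain rfl : y = y' := by
        have h1 := h.2.head_not_lt hl
        have h2 := h'.2.head_not_lt fun i => (hl i).symm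
        omega
      rw [ih h.2 h'.2 fun i => ?_]
      have := hl i
      simp only [layer] at this
      split_ifs at this <;> simp_all

/-- A word can be rebuilt from its lowest layer and from its letters above the lowest
level. -/
theorem exists_layer_zero_eq (w' : List ℕ) (u : List Bool) (x' : ℕ) (h : Climbs x' w')
    (hc : w'.count 0 = u.count false) :
    ∃ w, Climbs (x' + 1) w ∧ ((∀ y ∈ w'.head?, y = 0) → ∀ x, Climbs x w) ∧
      layer 0 w = u ∧ (∀ i, layer (i + 1) w = layer i w') ∧
      ∀ z ∈ w, z = 0 ∨ ∃ y ∈ w', z = y + 1 := by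
  induction w' generalizing u x' with
  | nil =>
    induction u with
    | nil => exact ⟨[], by simp [Climbs, layer]⟩
    | cons b u ih =>
      cases b with
      | false => simp at hc
      | true =>
        obtain ⟨w, -, h2, h3, h4, h5⟩ := ih (by simpa using hc)
        have h2 := h2 (by simp)
        refine ⟨0 :: w, by simp [Climbs, h2], by simp [Climbs, h2], by simp [layer, h3],
          fun i => by simp [layer, h4], fun z hz => ?_⟩
        rcases List.mem_cons.1 hz with rfl | hz
        · simp
        · exact h5 z hz
  | cons y t iht =>
    cases y with
    | succ y =>
      obtain ⟨w, h1, -, h3, h4, h5⟩ := iht u (y + 1) h.2 (by simpa using hc)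
      have := h.1
      refine ⟨(y + 2) :: w, ⟨by omega, h1⟩, by simp, by simp [layer, h3],
        fun i => by simp [layer, h4], fun z hz => ?_⟩
      rcases List.mem_cons.1 hz with rfl | hz
      · exact .inr ⟨y + 1, by simp, rfl⟩
      · rcases h5 z hz with h | ⟨v, hv, h⟩
        · exact .inl h
        · exact .inr ⟨v, by simp [hv], h⟩
    | zero =>
      induction u with
      | nil => simp at hc
      | cons b u ih =>
        cases b with
        | false =>
          obtain ⟨w, h1, -, h3, h4, h5⟩ := iht u 0 h.2 (by simpa using hc)
          refine ⟨1 :: w, ⟨by omega, h1⟩, fun _ x => ⟨by omega, h1⟩, by simp [layer, h3],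
            fun i => by simp [layer, h4, eq_comm], fun z hz => ?_⟩
          rcases List.mem_cons.1 hz with rfl | hz
          · exact .inr ⟨0, by simp, rfl⟩
          · rcases h5 z hz with h | ⟨v, hv, h⟩
            · exact .inl h
            · exact .inr ⟨v, by simp [hv], h⟩
        | true =>
          obtain ⟨w, -, h2, h3, h4, h5⟩ := ih (by simpa using hc)
          have h2 := h2 (by simp)
          refine ⟨0 :: w, ⟨by omega, h2 0⟩, fun _ x => ⟨by omega, h2 0⟩, by simp [layer, h3],
            fun i => by simp [layer, h4], fun z hz => ?_⟩
          rcases List.mem_cons.1 hz with rfl | hz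
          · simp
          · exact h5 z hz

/-! ## Ladders: sequences of compatible layers -/

/-- Consecutive rungs share a letter, and every rung but the first starts with `true`. -/
def IsLadder : List (List Bool) → Prop
  | [] => True
  | u :: C => u.count false = (C.headD []).count true ∧
      (C.headD []).head? ≠ some false ∧ IsLadder C

theorem isLadder_layers {w : List ℕ} (h : Climbs 0 w) (N i : ℕ) (hN : ∀ x ∈ w, x < i + N) :
    IsLadder (layers N i w) := by
  induction N generalizing i with
  | zero => trivial
  | succ N ih =>
    refine ⟨?_, ?_, ih (i + 1) fun x hx => by have := hN x hx; omega⟩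
    · rw [count_false_layer]
      cases N with
      | zero =>
        simp only [layers, List.headD_nil, List.count_nil, List.count_eq_zero]
        intro h
        have := hN _ h
        omega
      | succ N => simp [layers, count_true_layer]
    · cases N with
      | zero => simp [layers]
      | succ N => simpa [layers] using h.head?_layer (i := i + 1) (by omega)

theorem IsLadder.exists_word {C : List (List Bool)} (hC : IsLadder C) :
    ∃ w, Climbs 0 w ∧ (∀ x ∈ w, x < C.length) ∧ layers C.length 0 w = C := by
  induction C with
  | nil => exact ⟨[], by simp [Climbs, layers]⟩
  | cons u C ih =>
    obtain ⟨w', h1, h2, h3⟩ := ih hC.2.2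
    have hd : C.headD [] = layer 0 w' := by
      cases C with
      | nil =>
        have : w' = [] := List.eq_nil_iff_forall_not_mem.2 fun x hx => by simpa using h2 x hx
        simp [this, layer]
      | cons v C => 
        rw [← h3]; simp [layers]
    have hc := hC.1
    have hs := hC.2.1
    rw [hd] at hc hs
    rw [count_true_layer] at hc
    have hh : ∀ y ∈ w'.head?, y = 0 := by
      cases w' with
      | nil => simp
      | cons y t =>
        have := h1.1
        have hy : y ≠ 1 := by
          rintro rfl
          simp [layer] at hs
        simp; omega
    obtain ⟨w, -, g2, g3, g4, g5⟩ := exists_layer_zero_eq w' u 0 h1 hc.symm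
    refine ⟨w, g2 hh 0, fun x hx => ?_, ?_⟩
    · rcases g5 x hx with rfl | ⟨y, hy, rfl⟩
      · simp
      · have := h2 y hy
        simpa using this
    · rw [List.length_cons, layers, g3]
      congr 1
      rw [← layers_congr (i := 1) (i' := 0) (w := w) (w' := w') (fun j => by
        rw [add_comm, g4, zero_add]) C.length] at h3
      exact h3

/-! ## Weaving a ladder into a pair of paths -/

/-- The concatenation of every other rung, starting with the first. -/
def weave : List (List Bool) → List Bool
  | [] => []
  | [u] => u
  | u :: _ :: C => u ++ weave C

/-- The number of pairs formed by a `true` and a later `false`. -/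
def trueFalsePairs : List Bool → ℕ
  | [] => 0
  | true :: l => l.count false + trueFalsePairs l
  | false :: l => trueFalsePairs l

/-- The number of pairs formed by a `false` and a later `true`. -/
def falseTruePairs : List Bool → ℕ
  | [] => 0
  | true :: l => falseTruePairs l
  | false :: l => l.count true + falseTruePairs l

theorem weave_cons (u : List Bool) (C : List (List Bool)) :
    weave (u :: C) = u ++ weave C.tail := by
  cases C <;> simp [weave]

theorem count_true_map_not (l : List Bool) : (l.map (!·)).count true = l.count false := by
  induction l with
  | nil => rfl
  | cons b l ih => cases b <;> simp_all

theorem count_false_map_not (l : List Bool) : (l.map (!·)).count false = l.count true := by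
  induction l with
  | nil => rfl
  | cons b l ih => cases b <;> simp_all

theorem map_not_map_not (l : List Bool) : (l.map (!·)).map (!·) = l := by
  simp [Function.comp_def]

theorem head?_map_not {l : List Bool} {b : Bool} (h : l.head? ≠ some b) :
    (l.map (!·)).head? ≠ some (!b) := by
  cases l <;> simp_all

theorem head?_append_ne {a l : List Bool} {b : Bool} (ha : a.head? ≠ some b)
    (hl : l.head? ≠ some b) : (a ++ l).head? ≠ some b := by
  cases a <;> simp_all

theorem IsLadder.tail {C : List (List Bool)} (h : IsLadder C) : IsLadder C.tail := by
  cases C with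
  | nil => trivial
  | cons u C => exact h.2.2

theorem IsLadder.head?_weave {C : List (List Bool)} (h : IsLadder C)
    (h0 : (C.headD []).head? ≠ some false) : (weave C).head? ≠ some false := by
  induction hl : C.length using Nat.strong_induction_on generalizing C with
  | _ N ih =>
    match C, h, h0, hl with
    | [], _, _, _ => simp [weave]
    | [u], _, h0, _ => simpa [weave] using h0
    | u :: v :: C, h, h0, hl =>
      rw [weave]
      refine head?_append_ne h0 (ih C.length ?_ h.2.2.2.2 h.2.2.2.1 rfl)
      simp at hl; omega

theorem IsLadder.head?_weave_tail {C : List (List Bool)} (h : IsLadder C) :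
    (weave C.tail).head? ≠ some false := by
  cases C with
  | nil => simp [weave]
  | cons u C => exact h.2.2.head?_weave h.2.1

theorem IsLadder.count_weave {C : List (List Bool)} (h : IsLadder C) :
    (weave C).count true = (C.headD []).count true + (weave C.tail).count false ∧
      (weave C).count false = (weave C.tail).count true := by
  induction C with
  | nil => simp [weave]
  | cons u C ih =>
    obtain ⟨h1, h2⟩ := ih h.2.2
    have := h.1
    simp only [weave_cons, List.count_append, List.headD_cons, List.tail_cons]
    omega

theorem trueFalsePairs_append (a l : List Bool) :
    trueFalsePairs (a ++ l) =
      trueFalsePairs a + a.count true * l.count false + trueFalsePairs l := by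
  induction a with
  | nil => simp [trueFalsePairs]
  | cons b a ih => cases b <;> (simp [trueFalsePairs, ih]; try ring)

theorem trueFalsePairs_map_not (l : List Bool) :
    trueFalsePairs (l.map (!·)) = falseTruePairs l := by
  induction l with
  | nil => rfl
  | cons b l ih =>
    cases b
    · simp only [List.map_cons, Bool.not_false, trueFalsePairs, falseTruePairs, ih,
        count_false_map_not]
    · simp only [List.map_cons, Bool.not_true, trueFalsePairs, falseTruePairs, ih]

theorem trueFalsePairs_replicate_append (v : ℕ) (l : List Bool) :
    trueFalsePairs (List.replicate v true ++ l) = v * l.count false + trueFalsePairs l := by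
  induction v with
  | zero => simp
  | succ v ih =>
    simp [List.replicate_succ, trueFalsePairs, ih, List.count_replicate]
    ring

theorem trueFalsePairs_add_falseTruePairs (l : List Bool) :
    trueFalsePairs l + falseTruePairs l = l.count true * l.count false := by
  induction l with
  | nil => rfl
  | cons b l ih => cases b <;> (simp [trueFalsePairs, falseTruePairs]; linarith)

theorem IsLadder.pairs_weave {C : List (List Bool)} (h : IsLadder C) :
    (C.headD []).count true * (weave C.tail).count true + falseTruePairs (weave C.tail) =
      trueFalsePairs (weave C) + (C.map falseTruePairs).sum := by
  induction C with
  | nil => simp [weave, trueFalsePairs, falseTruePairs]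
  | cons u C ih =>
    have ih := ih h.2.2
    obtain ⟨h1, h2⟩ := h.2.2.count_weave
    have h3 := h.1
    have e1 := trueFalsePairs_add_falseTruePairs u
    have e2 := trueFalsePairs_add_falseTruePairs (weave C)
    have e3 := trueFalsePairs_add_falseTruePairs (weave C.tail)
    simp only [weave_cons, trueFalsePairs_append, List.headD_cons, List.tail_cons,
      List.map_cons, List.sum_cons]
    rw [← h3] at h1 ih
    rw [h2] at e2
    rw [h1] at e2 ⊢
    nlinarith

/-- The initial segment of `q` up to the step `true` following the first `v` ones. -/
theorem exists_eq_append_count_true (q : List Bool) (v : ℕ) (hv : v ≤ q.count true) :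
    ∃ u q', q = u ++ q' ∧ u.count true = v ∧ q'.head? ≠ some false := by
  induction q generalizing v with
  | nil => exact ⟨[], [], by simpa [eq_comm] using hv⟩
  | cons b q ih =>
    cases b with
    | false =>
      obtain ⟨u, q', rfl, h1, h2⟩ := ih v (by simpa using hv)
      exact ⟨false :: u, q', by simp, by simpa using h1, h2⟩
    | true =>
      cases v with
      | zero => exact ⟨[], true :: q, by simp⟩
      | succ v =>
        obtain ⟨u, q', rfl, h1, h2⟩ := ih v (by simpa using hv)
        exact ⟨true :: u, q', by simp, by simpa using h1, h2⟩

theorem append_cancel_of_count_true {a a' l l' : List Bool} (h : a ++ l = a' ++ l')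
    (hc : a.count true = a'.count true) (hl : l.head? ≠ some false)
    (hl' : l'.head? ≠ some false) : a = a' ∧ l = l' := by
  induction a generalizing a' with
  | nil =>
    cases a' with
    | nil => simpa using h
    | cons b a' => cases b <;> simp_all
  | cons b a ih =>
    cases a' with
    | nil => cases b <;> simp_all [eq_comm]
    | cons b' a' =>
      simp only [List.cons_append, List.cons.injEq] at h
      obtain ⟨rfl, h⟩ := h
      have := ih h (by cases b <;> simpa using hc)
      simp [this]

theorem IsLadder.eq_of_weave_eq {C C' : List (List Bool)} (h : IsLadder C) (h' : IsLadder C')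
    (hlen : C.length = C'.length) (hv : (C.headD []).count true = (C'.headD []).count true)
    (h0 : weave C = weave C') (h1 : weave C.tail = weave C'.tail) : C = C' := by
  induction C generalizing C' with
  | nil => exact (List.length_eq_zero_iff.1 hlen.symm).symm
  | cons u C ih =>
    cases C' with
    | nil => simp at hlen
    | cons u' C' =>
      rw [weave_cons, weave_cons] at h0
      simp only [List.tail_cons] at h1
      obtain ⟨rfl, h2⟩ := append_cancel_of_count_true h0 (by simpa using hv)
        h.2.2.head?_weave_tail h'.2.2.head?_weave_tail
      rw [ih h.2.2 h'.2.2 (by simpa using hlen) (by rw [← h.1, ← h'.1]) h1 h2]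

theorem count_take_add (l : List Bool) (i : ℕ) :
    (l.take i).count true + (l.take i).count false = min i l.length := by
  rw [List.count_true_add_count_false, List.length_take]

/-- The path which starts with `v` steps `true` followed by `p` stays above the path `q`. -/
def StaysAbove (v : ℕ) (p q : List Bool) : Prop :=
  ∀ i, (q.take (i + v)).count true ≤ v + (p.take i).count true

theorem staysAbove_append_iff {v : ℕ} {p u q' : List Bool} (hu : u.count true = v)
    (hlen : p.length = u.count false + q'.length) :
    StaysAbove v p (u ++ q') ↔ StaysAbove (u.count false) (q'.map (!·)) (p.map (!·)) := by
  have key : ∀ i, ((u ++ q').take (i + u.count false + v)).count true =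
      v + (q'.take i).count true := by
    intro i
    have hl := List.count_true_add_count_false u
    rw [show i + u.count false + v = u.length + i by omega, List.take_length_add_append,
      List.count_append, hu]
  have key2 : ∀ i, (((q'.map (!·)).take i).count true = (q'.take i).count false) ∧
      (((p.map (!·)).take i).count true = (p.take i).count false) := by
    intro i
    rw [← List.map_take, ← List.map_take, count_true_map_not, count_true_map_not]
    simp
  constructor
  · intro h i
    have h1 := h (i + u.count false)
    rw [key] at h1
    rw [(key2 _).1, (key2 _).2]
    have h2 := count_take_add q' i
    have h3 := count_take_add p (i + u.count false)
    omega
  · intro h j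
    rcases lt_or_ge j (u.count false) with hj | hj
    · have hl := List.count_true_add_count_false u
      rw [List.take_append_of_le_length (by omega)]
      have := (List.take_sublist (j + v) u).count_le true
      omega
    · obtain ⟨i, rfl⟩ := Nat.exists_eq_add_of_le' hj
      have h1 := h i
      rw [(key2 _).1, (key2 _).2] at h1
      rw [key]
      have h2 := count_take_add q' i
      have h3 := count_take_add p (i + u.count false)
      omega

theorem IsLadder.staysAbove {C : List (List Bool)} (h : IsLadder C) :
    StaysAbove ((C.headD []).count true) ((weave C.tail).map (!·)) (weave C) := by
  induction C with
  | nil => simp [StaysAbove, weave]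
  | cons u C ih =>
    have h1 := h.2.2.count_weave
    have h2 := h.1
    have h3 := List.count_true_add_count_false (weave C)
    have h4 := List.count_true_add_count_false (weave C.tail)
    rw [weave_cons, List.headD_cons, List.tail_cons, staysAbove_append_iff rfl
      (by rw [List.length_map]; omega), map_not_map_not, h.1]
    exact ih h.2.2

theorem exists_ladder (N : ℕ) (p q : List Bool) (hN : p.length + q.length ≤ N) (v : ℕ)
    (ht : q.count true = v + p.count true) (hf : q.count false = p.count false)
    (hp : p.head? ≠ some true) (ha : StaysAbove v p q) :
    ∃ C, C.length = N ∧ IsLadder C ∧ (C.headD []).count true = v ∧ weave C = q ∧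
      (weave C.tail).map (!·) = p := by
  induction N generalizing p q v with
  | zero =>
    have hp0 : p = [] := List.length_eq_zero_iff.1 (by omega)
    have hq0 : q = [] := List.length_eq_zero_iff.1 (by omega)
    subst hp0 hq0
    refine ⟨[], rfl, trivial, ?_, rfl, rfl⟩
    simpa using ht
  | succ N ih =>
    obtain ⟨u, q', rfl, hu, hq'⟩ := exists_eq_append_count_true q v (by omega)
    have l1 := List.count_true_add_count_false p
    have l2 := List.count_true_add_count_false q'
    have l3 := List.count_true_add_count_false u
    rw [List.count_append] at ht hf
    have hlen : p.length = u.count false + q'.length := by omega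
    have hle : q'.length + p.length ≤ N := by
      rw [List.length_append] at hN
      rcases Nat.eq_zero_or_pos u.length with h0 | h0
      · have hu0 := List.length_eq_zero_iff.1 h0
        subst hu0
        obtain rfl : v = 0 := by simpa using hu.symm
        have h1 := ha 1
        have : q' = [] := by
          cases q' with
          | nil => rfl
          | cons b q' =>
            cases b with
            | false => simp at hq'
            | true =>
              cases p with
              | nil => simp at h1
              | cons b p => cases b <;> simp_all
        subst this
        simp only [List.count_nil, List.length_nil] at ht hf ⊢
        omega
      · omega
    obtain ⟨C, hC1, hC2, hC3, hC4, hC5⟩ := ih (q'.map (!·)) (p.map (!·)) (by simpa using hle)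
      (u.count false) (by rw [count_true_map_not, count_true_map_not]; omega)
      (by rw [count_false_map_not, count_false_map_not]; omega)
      (by simpa using head?_map_not hq') ((staysAbove_append_iff hu hlen).1 ha)
    have hC6 : weave C.tail = q' := by
      rw [← map_not_map_not (weave C.tail), hC5, map_not_map_not]
    refine ⟨u :: C, by simp [hC1], ⟨hC3.symm, ?_, hC2⟩, by simpa using hu, ?_, ?_⟩
    · have h1 : (weave C).head? ≠ some false := by
        rw [hC4]; simpa using head?_map_not hp
      cases C with
      | nil => simp
      | cons x C =>
        rw [weave_cons] at h1
        cases x <;> simp_all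
    · rw [weave_cons, hC6]
    · rw [List.tail_cons, hC4, map_not_map_not]

/-! ## Statistics of words -/

/-- The number of pairs of a letter and a later letter whose successor it is. -/
def wordDinv : List ℕ → ℕ
  | [] => 0
  | x :: w => w.countP (fun y => x = y + 1) + wordDinv w

theorem sum_falseTruePairs_layers (w : List ℕ) (N i : ℕ) :
    ((layers N i w).map falseTruePairs).sum =
      ∑ j ∈ range N, falseTruePairs (layer (i + j) w) := by
  induction N generalizing i with
  | zero => rfl
  | succ N ih =>
    rw [layers, List.map_cons, List.sum_cons, ih, Finset.sum_range_succ', add_comm]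
    simp only [add_zero, add_assoc, add_comm 1]

theorem sum_falseTruePairs_layer (w : List ℕ) (N : ℕ) (h : ∀ x ∈ w, x < N) :
    ∑ j ∈ range N, falseTruePairs (layer j w) = wordDinv w := by
  induction w with
  | nil => simp [layer, falseTruePairs, wordDinv]
  | cons x w ih =>
    have hx : x < N := h x (by simp)
    have key : ∀ j, falseTruePairs (layer j (x :: w)) =
        (if x = j + 1 then w.count j else 0) + falseTruePairs (layer j w) := by
      intro j
      rw [layer]
      split_ifs <;> simp_all [falseTruePairs, count_true_layer]
    simp only [key, Finset.sum_add_distrib, wordDinv]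
    rw [ih fun y hy => h y (by simp [hy])]
    congr 1
    cases x with
    | zero => simp
    | succ x =>
      simp only [Nat.add_right_cancel_iff]
      rw [Finset.sum_ite_eq (range N) x (fun j => w.count j), if_pos (by simp; omega),
        List.count_eq_countP]
      exact List.countP_congr fun y _ => by rw [beq_iff_eq, decide_eq_true_iff, eq_comm]

theorem weave_layers_add_two (N i : ℕ) (w : List ℕ) :
    weave (layers (N + 2) i w) = layer i w ++ weave (layers N (i + 2) w) := rfl

theorem countP_eq_count_add {w : List ℕ} {p q : ℕ → Bool} {i : ℕ}
    (h : ∀ x ∈ w, p x = (x == i || q x)) (hi : q i = false) :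
    w.countP p = w.count i + w.countP q := by
  induction w with
  | nil => rfl
  | cons x w ih =>
    have ih := ih fun y hy => h y (by simp [hy])
    have hx := h x (by simp)
    simp only [List.countP_cons, List.count_cons, ih, hx]
    by_cases hxi : x = i
    · subst hxi
      simp [hi, add_right_comm, add_assoc]
    · by_cases hq : q x <;> simp [hxi, hq, add_assoc]

theorem count_weave_layers (w : List ℕ) (N i : ℕ) (h : ∀ x ∈ w, x < i + N) :
    (weave (layers N i w)).count true = w.countP (fun x => i ≤ x ∧ x % 2 = i % 2) ∧
      (weave (layers N i w)).count false = w.countP (fun x => i < x ∧ x % 2 = (i + 1) % 2) := by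
  induction N using Nat.twoStepInduction generalizing i with
  | zero =>
    simp only [layers, weave, List.count_nil]
    constructor <;> symm <;> rw [List.countP_eq_zero] <;> intro x hx <;> have := h x hx <;>
      simp <;> omega
  | one =>
    simp only [layers, weave, count_true_layer, count_false_layer]
    rw [List.count_eq_countP, List.count_eq_countP]
    constructor <;> refine List.countP_congr fun x hx => ?_ <;> have := h x hx <;> simp <;>
      omega
  | more N ih _ =>
    have ih := ih (i + 2) fun x hx => by have := h x hx; omega
    rw [weave_layers_add_two, List.count_append, List.count_append, ih.1, ih.2,
      count_true_layer, count_false_layer]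
    constructor <;> symm <;> apply countP_eq_count_add <;> grind

/-! ## Heights and bounces -/

/-- The number of steps `true` preceding the `(x+1)`-st step `false`. -/
def listHeight : List Bool → ℕ → ℕ
  | [], _ => 0
  | true :: l, x => listHeight l x + 1
  | false :: _, 0 => 0
  | false :: l, x + 1 => listHeight l x

theorem listHeight_append (a l : List Bool) (x : ℕ) :
    listHeight (a ++ l) (a.count false + x) = a.count true + listHeight l x := by
  induction a with
  | nil => simp
  | cons b a ih =>
    cases b
    · simp [show a.count false + 1 + x = a.count false + x + 1 by omega, listHeight, ih]
    · simp [listHeight, ih]; omega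

theorem listHeight_zero {l : List Bool} (h : l.head? ≠ some true) : listHeight l 0 = 0 := by
  match l, h with
  | [], _ => rfl
  | false :: l, _ => rfl

theorem listHeight_replicate_append (v : ℕ) (l : List Bool) (x : ℕ) :
    listHeight (List.replicate v true ++ l) x = v + listHeight l x := by
  simpa [List.count_replicate] using listHeight_append (List.replicate v true) l x

/-- The corner points of the bounce path between the upper path `r` and the lower path
`g`. -/
def listBounce (r g : List Bool) : ℕ → ℕ × ℕ
  | 0 => (0, 0)
  | k + 1 =>
    (listHeight (g.map (!·)) (listHeight r (listBounce r g k).1),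
      listHeight r (listBounce r g k).1)

/-- The upper path obtained from a ladder. -/
def upperPath (C : List (List Bool)) : List Bool :=
  List.replicate ((C.headD []).count true) true ++ (weave C.tail).map (!·)

theorem IsLadder.listBounce_cons {u : List Bool} {C : List (List Bool)}
    (h : IsLadder (u :: C)) (k : ℕ) :
    (listBounce (upperPath (u :: C)) (weave (u :: C)) k).1 =
        (listBounce (upperPath C) (weave C) k).2 ∧
      (listBounce (upperPath (u :: C)) (weave (u :: C)) (k + 1)).2 =
        u.count true + (listBounce (upperPath C) (weave C) k).1 := by
  have hr : ∀ x, listHeight (upperPath (u :: C)) x =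
      u.count true + listHeight ((weave C).map (!·)) x := by
    intro x
    rw [upperPath, listHeight_replicate_append]
    rfl
  have hg : ∀ x, listHeight ((weave (u :: C)).map (!·)) (u.count true + x) =
      listHeight (upperPath C) x := by
    intro x
    rw [weave_cons, List.map_append, upperPath, listHeight_replicate_append, ← h.1,
      ← count_false_map_not, listHeight_append, count_true_map_not]
  induction k with
  | zero =>
    refine ⟨rfl, ?_⟩
    simp only [listBounce, hr]
    rw [listHeight_zero]
    simpa using head?_map_not (h.2.2.head?_weave h.2.1)
  | succ k ih =>
    have h1 : (listBounce (upperPath (u :: C)) (weave (u :: C)) (k + 1)).1 =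
        (listBounce (upperPath C) (weave C) (k + 1)).2 := by
      have := hg (listBounce (upperPath C) (weave C) k).1
      rw [← ih.2] at this
      exact this
    refine ⟨h1, ?_⟩
    rw [listBounce, h1, hr]
    rfl

theorem listBounce_layers {w : List ℕ} (hw : Climbs 0 w) (N i : ℕ)
    (h : ∀ x ∈ w, x < i + N) (k : ℕ) :
    listBounce (upperPath (layers N i w)) (weave (layers N i w)) k =
      (w.countP (fun x => i < x ∧ x % 2 = (i + 1) % 2 ∧ x < i + 2 * k),
        w.countP (fun x => i ≤ x ∧ x % 2 = i % 2 ∧ x < i + 2 * k)) := by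
  induction N generalizing i k with
  | zero =>
    have h0 : listBounce (upperPath (layers 0 i w)) (weave (layers 0 i w)) k = (0, 0) := by
      cases k <;> rfl
    rw [h0, Prod.mk.injEq]
    constructor <;> symm <;> rw [List.countP_eq_zero] <;> intro x hx <;> have := h x hx <;>
      simp <;> omega
  | succ N ih =>
    have h' : ∀ x ∈ w, x < i + 1 + N := fun x hx => by have := h x hx; omega
    have hC : IsLadder (layers (N + 1) i w) := isLadder_layers hw _ _ h
    refine Prod.ext ?_ ?_
    · rw [layers, (hC.listBounce_cons k).1, ih (i + 1) h']
      refine List.countP_congr fun x hx => ?_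
      simp; omega
    · cases k with
      | zero =>
        simp only [listBounce]
        symm
        rw [List.countP_eq_zero]
        intro x hx
        simp; omega
      | succ k =>
        rw [layers, (hC.listBounce_cons k).2, ih (i + 1) h', count_true_layer]
        symm
        apply countP_eq_count_add <;> grind

/-! ## Rises and valleys -/

/-- The number of steps `false` preceded by a step `true`, where `b` stands before the
first step. -/
def descents : Bool → List Bool → ℕ
  | _, [] => 0
  | b, c :: l => (if b = true ∧ c = false then 1 else 0) + descents c l

/-- The numeric values of the even letters of `w` preceded by their predecessor, where `x`
stands before the first letter. -/
def riseValues : ℕ → List ℕ → List ℕ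
  | _, [] => []
  | x, y :: w => (if x % 2 = 1 ∧ y = x + 1 then [y / 2] else []) ++ riseValues y w

/-- The labels of the valleys of a path starting at height `y`, where `L` gives the label
of each row and `b` stands before the first step. -/
def valleyLabels (L : ℕ → ℕ) : Bool → ℕ → List Bool → List ℕ
  | _, _, [] => []
  | b, y, true :: l => (if b = false then [L y] else []) ++ valleyLabels L true (y + 1) l
  | _, y, false :: l => valleyLabels L false y l

theorem descents_eq {l : List Bool} (h : l.head? ≠ some false) (b b' : Bool) :
    descents b l = descents b' l := by
  match l, h with
  | [], _ => rfl
  | true :: l, _ => simp [descents]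

theorem valleyLabels_eq (L : ℕ → ℕ) {l : List Bool} (h : l.head? ≠ some true) (b b' : Bool)
    (y : ℕ) : valleyLabels L b y l = valleyLabels L b' y l := by
  match l, h with
  | [], _ => rfl
  | false :: l, _ => rfl

theorem Climbs.count_riseValues {x : ℕ} {w : List ℕ} (h : Climbs x w) (a : ℕ) :
    (riseValues x w).count (a + 1) =
      descents (decide (x = 2 * a + 1)) (layer (2 * a + 1) w) := by
  induction w generalizing x with
  | nil => rfl
  | cons y w ih =>
    have ih := ih h.2
    have hy := h.1
    rw [riseValues, List.count_append, ih, layer]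
    by_cases h1 : y = 2 * a + 1
    · rw [if_pos h1, if_neg (by omega)]
      simp [descents, h1]
    by_cases h2 : y = 2 * a + 1 + 1
    · rw [if_neg h1, if_pos h2, descents]
      by_cases h3 : x = 2 * a + 1
      · rw [if_pos (by omega), List.count_singleton]
        simp [h1, h3]
        omega
      · rw [if_neg (by omega)]
        simp [h1, h3]
    · rw [if_neg h1, if_neg h2, List.count_eq_zero.2, zero_add]
      · by_cases h3 : x = 2 * a + 1
        · exact descents_eq (h.2.head?_layer (by omega)) _ _
        · simp [h1, h3]
      · split_ifs
        · simp; omega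
        · simp

theorem zero_notMem_riseValues (x : ℕ) (w : List ℕ) : 0 ∉ riseValues x w := by
  induction w generalizing x with
  | nil => simp [riseValues]
  | cons y w ih =>
    rw [riseValues, List.mem_append]
    rintro (h | h)
    · split_ifs at h
      · simp at h; omega
      · simp at h
    · exact ih y h

theorem valleyLabels_map_not_append (L : ℕ → ℕ) (u l : List Bool) (b : Bool) (y c : ℕ)
    (hL : ∀ z, y ≤ z → z < y + u.count false → L z = c) (hl : l.head? ≠ some true) :
    valleyLabels L b y (u.map (!·) ++ l) =
      List.replicate (descents (!b) u) c ++ valleyLabels L true (y + u.count false) l := by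
  induction u generalizing b y with
  | nil => simpa [descents] using valleyLabels_eq L hl b true y
  | cons d u ih =>
    cases d with
    | false =>
      have h1 := hL y le_rfl (by simp)
      have h2 := ih true (y + 1) fun z hz hz' => hL z (by omega) (by simp; omega)
      simp only [List.map_cons, Bool.not_false, List.cons_append, valleyLabels, h2, h1,
        descents, List.count_cons]
      rw [show y + 1 + u.count false = y + (u.count false + 1) by omega]
      cases b <;> simp [List.replicate_add]
    | true =>
      have h2 := ih false y fun z hz hz' => hL z (by omega) (by simpa using hz')
      simp [valleyLabels, h2, descents]

theorem count_valleyLabels_weave {w : List ℕ} (hw : Climbs 0 w) (L : ℕ → ℕ) (M : ℕ)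
    (hM : ∀ x ∈ w, x ≤ 2 * M)
    (hL : ∀ k y, k ≤ M → w.countP (fun x => x % 2 = 0 ∧ x < 2 * k) ≤ y →
      y < w.countP (fun x => x % 2 = 0 ∧ x < 2 * (k + 1)) → L y = k)
    (N k : ℕ) (b : Bool) (hN : ∀ x ∈ w, x < 2 * k + 1 + N) (a : ℕ) :
    (valleyLabels L b (w.countP fun x => x % 2 = 0 ∧ x < 2 * (k + 1))
        ((weave (layers N (2 * k + 1) w)).map (!·))).count a =
      if k < a then descents false (layer (2 * a - 1) w) else 0 := by
  induction N using Nat.strong_induction_on generalizing k b with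
  | _ N ih =>
  rcases Nat.eq_zero_or_pos N with rfl | hpos
  · rw [layers, weave, List.map_nil, valleyLabels, List.count_nil]
    split_ifs with h
    · rw [layer_eq_nil fun x hx => by have := hN x hx; omega, descents]
    · rfl
  have hw1 : ∀ N', weave (layers (N' + 1) (2 * k + 1) w) =
      layer (2 * k + 1) w ++ weave (layers (N' - 1) (2 * (k + 1) + 1) w) := by
    intro N'
    cases N' with
    | zero => simp [layers, weave]
    | succ N' => exact weave_layers_add_two _ _ _
  obtain ⟨N, rfl⟩ := Nat.exists_eq_add_of_le' hpos
  have hC : IsLadder (layers (N + 1) (2 * k + 1) w) := isLadder_layers hw _ _ hN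
  have hlast : (layers (N + 1) (2 * k + 1) w).tail.tail =
      layers (N - 1) (2 * (k + 1) + 1) w := by
    cases N <;> rfl
  have hhead : ((weave (layers (N - 1) (2 * (k + 1) + 1) w)).map (!·)).head? ≠ some true := by
    rw [← hlast]
    simpa using head?_map_not hC.tail.head?_weave_tail
  have hcnt : w.countP (fun x => x % 2 = 0 ∧ x < 2 * (k + 1 + 1)) =
      w.countP (fun x => x % 2 = 0 ∧ x < 2 * (k + 1)) + w.count (2 * (k + 1)) := by
    rw [add_comm (List.countP _ _)]
    apply countP_eq_count_add <;> grind
  have hlab : ∀ z, w.countP (fun x => x % 2 = 0 ∧ x < 2 * (k + 1)) ≤ z →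
      z < w.countP (fun x => x % 2 = 0 ∧ x < 2 * (k + 1)) +
        (layer (2 * k + 1) w).count false → L z = k + 1 := by
    intro z hz hz'
    rw [count_false_layer, show 2 * k + 1 + 1 = 2 * (k + 1) by ring] at hz'
    have hmem : 2 * (k + 1) ∈ w := by
      by_contra hne
      rw [List.count_eq_zero.2 hne] at hz'
      omega
    have := hM _ hmem
    exact hL (k + 1) z (by omega) hz (by omega)
  rw [hw1, List.map_append, valleyLabels_map_not_append L _ _ b _ (k + 1) hlab hhead,
    count_false_layer, show 2 * k + 1 + 1 = 2 * (k + 1) by ring, ← hcnt, List.count_append,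
    ih (N - 1) (by omega) (k + 1) true fun x hx => ?_, List.count_replicate,
    descents_eq (hw.head?_layer (by omega)) (!b) false]
  · rcases lt_trichotomy a (k + 1) with h | rfl | h
    · simp [show ¬ k + 1 = a by omega, show ¬ k + 1 < a by omega, show ¬ k < a by omega]
    · simp [show 2 * (k + 1) - 1 = 2 * k + 1 by omega]
    · simp [show ¬ k + 1 = a by omega, show k + 1 < a by omega, show k < a by omega]
  · have := hN x hx
    omega

theorem sum_countP_even (w : List ℕ) (c M : ℕ) (h : ∀ x ∈ w, x ≤ 2 * M) :
    ∑ k ∈ range M, w.countP (fun x => x % 2 = c ∧ 2 * (k + 1) ≤ x) =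
      ((w.filter fun x => x % 2 = c).map (· / 2)).sum := by
  induction w with
  | nil => simp
  | cons x w ih =>
    have ih := ih fun y hy => h y (by simp [hy])
    have hx := h x (by simp)
    simp only [List.countP_cons, Finset.sum_add_distrib, ih, List.filter_cons]
    by_cases hc : x % 2 = c
    · simp only [hc, true_and, decide_true, if_true, List.map_cons, List.sum_cons,
        decide_eq_true_eq]
      rw [Finset.sum_boole, add_comm]
      congr 1
      rw [show (range M).filter (fun k => 2 * (k + 1) ≤ x) = range (x / 2) by
        ext k; simp; omega]
      simp
    · simp [hc]

/-! ## Functions on `Fin N` and lists -/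

theorem countP_ofFn_eq_card {α : Type*} {N : ℕ} (f : Fin N → α) (p : α → Bool) :
    (List.ofFn f).countP p = (univ.filter fun i => p (f i) = true).card := by
  induction N with
  | zero => simp
  | succ N ih =>
    rw [List.ofFn_succ, List.countP_cons, ih, Fin.card_filter_univ_succ]
    split_ifs <;> simp_all

theorem count_ofFn_eq_card {α : Type*} [DecidableEq α] {N : ℕ} (f : Fin N → α) (a : α) :
    (List.ofFn f).count a = (univ.filter fun i => f i = a).card := by
  rw [List.count_eq_countP, countP_ofFn_eq_card]
  simp

theorem count_take_ofFn {N : ℕ} (f : Fin N → Bool) (i : ℕ) :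
    ((List.ofFn f).take i).count true =
      (univ.filter fun j : Fin N => (j : ℕ) < i ∧ f j = true).card := by
  induction N generalizing i with
  | zero => simp
  | succ N ih =>
    cases i with
    | zero => simp
    | succ i =>
      rw [List.ofFn_succ, List.take_succ_cons, List.count_cons, ih, Fin.card_filter_univ_succ]
      cases h : f 0 <;> simp

theorem map_not_ofFn {N : ℕ} (f : Fin N → Bool) :
    (List.ofFn f).map (!·) = List.ofFn fun i => !f i := by
  rw [List.map_ofFn]
  rfl

theorem truesBefore_zero {N : ℕ} (f : Fin (N + 1) → Bool) : truesBefore f 0 = 0 := by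
  simp [truesBefore]

theorem truesBefore_succ {N : ℕ} (f : Fin (N + 1) → Bool) (j : Fin N) :
    truesBefore f j.succ = (if f 0 = true then 1 else 0) + truesBefore (fun i => f i.succ) j := by
  rw [truesBefore, Fin.card_filter_univ_succ]
  cases h : f 0 <;> simp [truesBefore, add_comm]

theorem falsesBefore_eq {N : ℕ} (f : Fin N → Bool) (j : Fin N) :
    falsesBefore f j = truesBefore (fun i => !f i) j := by
  simp [falsesBefore, truesBefore]

theorem heightAt_eq_listHeight {N : ℕ} (f : Fin N → Bool) (x : ℕ) :
    heightAt f x = listHeight (List.ofFn f) x := by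
  induction N generalizing x with
  | zero => simp [heightAt, listHeight]
  | succ N ih =>
    rw [List.ofFn_succ, heightAt, Fin.card_filter_univ_succ]
    simp only [heightAt] at ih
    cases h : f 0 with
    | true =>
      rw [listHeight, ← ih]
      simp [falsesBefore_eq, truesBefore_zero, truesBefore_succ, h]
    | false =>
      cases x with
      | zero =>
        simp [falsesBefore_eq, truesBefore_succ, h, listHeight]
      | succ x =>
        rw [listHeight, ← ih]
        simp [falsesBefore_eq, truesBefore_succ, h, add_comm 1]

theorem xcoordAt_eq_listHeight {N : ℕ} (f : Fin N → Bool) (y : ℕ) :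
    xcoordAt f y = listHeight ((List.ofFn f).map (!·)) y := by
  rw [map_not_ofFn, ← heightAt_eq_listHeight]
  simp [xcoordAt, heightAt, falsesBefore_eq]

theorem bouncePt_eq_listBounce {m n : ℕ} (P : RedPoly m n) (k : ℕ) :
    bouncePt P k = listBounce (List.ofFn P.red) (List.ofFn P.green) k := by
  induction k with
  | zero => rfl
  | succ k ih =>
    rw [bouncePt, listBounce, ih, heightAt_eq_listHeight, xcoordAt_eq_listHeight]

theorem cons_castSucc_eq_iff {α : Type*} {N : ℕ} (f : Fin N → α) (b : α) (j : Fin N)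
    (p : α → Prop) (hb : ¬ p b) :
    p ((Fin.cons b f : Fin (N + 1) → α) j.castSucc) ↔ ∃ i : Fin N, (i : ℕ) + 1 = j ∧ p (f i) := by
  rcases Nat.eq_zero_or_pos (j : ℕ) with h | h
  · rw [show j.castSucc = 0 from Fin.ext h, Fin.cons_zero]
    simp only [hb, false_iff, not_exists]
    intro i hi
    omega
  · have hlt : (j : ℕ) - 1 < N := by omega
    rw [show j.castSucc = Fin.succ ⟨(j : ℕ) - 1, hlt⟩ from Fin.ext (by simp; omega),
      Fin.cons_succ]
    constructor
    · intro hp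
      exact ⟨_, by simp; omega, hp⟩
    · rintro ⟨i, hi, hp⟩
      rwa [show (⟨(j : ℕ) - 1, hlt⟩ : Fin N) = i from Fin.ext (by simp; omega)]

theorem card_filter_valley {N : ℕ} (f : Fin N → Bool) (L : ℕ → ℕ) (b : Bool) (y a : ℕ) :
    (univ.filter fun j : Fin N => (f j = true ∧
      (Fin.cons b f : Fin (N + 1) → Bool) j.castSucc = false) ∧
        a = L (y + truesBefore f j)).card =
      (valleyLabels L b y (List.ofFn f)).count a := by
  induction N generalizing b y with
  | zero => simp [valleyLabels]
  | succ N ih =>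
    have hc : ∀ j : Fin N, (Fin.cons b f : Fin (N + 2) → Bool) j.succ.castSucc =
        (Fin.cons (f 0) (fun i => f i.succ) : Fin (N + 1) → Bool) j.castSucc := by
      intro j
      rw [← Fin.succ_castSucc, Fin.cons_succ]
      exact congrFun (Fin.cons_self_tail f).symm _
    rw [List.ofFn_succ, Fin.card_filter_univ_succ]
    simp only [hc, truesBefore_succ, truesBefore_zero, add_zero, ← add_assoc,
      Fin.castSucc_zero, Fin.cons_zero]
    have ih := ih (fun i => f i.succ) (f 0) (y + if f 0 = true then 1 else 0)
    rw [ih]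
    cases h : f 0 with
    | false => simp [valleyLabels]
    | true =>
      by_cases ha : a = L y
      · cases b <;> simp [valleyLabels, ha, add_comm]
      · cases b <;> simp [valleyLabels, ha, Ne.symm ha]

theorem card_filter_rise {N : ℕ} (f : Fin N → ℕ) (x a : ℕ) :
    (univ.filter fun j : Fin N => ((Fin.cons x f : Fin (N + 1) → ℕ) j.castSucc % 2 = 1 ∧
      f j = (Fin.cons x f : Fin (N + 1) → ℕ) j.castSucc + 1) ∧ a = f j / 2).card =
      (riseValues x (List.ofFn f)).count a := by
  induction N generalizing x with
  | zero => simp [riseValues]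
  | succ N ih =>
    have hc : ∀ j : Fin N, (Fin.cons x f : Fin (N + 2) → ℕ) j.succ.castSucc =
        (Fin.cons (f 0) (fun i => f i.succ) : Fin (N + 1) → ℕ) j.castSucc := by
      intro j
      rw [← Fin.succ_castSucc, Fin.cons_succ]
      exact congrFun (Fin.cons_self_tail f).symm _
    rw [List.ofFn_succ, Fin.card_filter_univ_succ]
    simp only [hc, Fin.castSucc_zero, Fin.cons_zero]
    rw [ih (fun i => f i.succ) (f 0), riseValues, List.count_append]
    by_cases h : x % 2 = 1 ∧ f 0 = x + 1
    · by_cases ha : a = f 0 / 2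
      · rw [if_pos ⟨h, ha⟩, if_pos h, ha]
        simp [add_comm]
      · rw [if_neg (by tauto), if_pos h]
        simp [Ne.symm ha]
    · rw [if_neg (by tauto), if_neg h]
      simp

theorem card_filter_dinv {N : ℕ} (f : Fin N → ℕ) :
    (univ.filter fun p : Fin N × Fin N => p.1 < p.2 ∧ f p.1 = f p.2 + 1).card =
      wordDinv (List.ofFn f) := by
  induction N with
  | zero => simp [wordDinv]
  | succ N ih =>
    rw [List.ofFn_succ, wordDinv, ← ih, countP_ofFn_eq_card]
    simp only [Finset.card_filter, Fintype.sum_prod_type, Fin.sum_univ_succ]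
    simp [Fin.succ_lt_succ_iff]

/-! ## The area of a reduced polyomino -/

/-- The steps of `r` alternating with the complementary steps of `g`. -/
def interlace : List Bool → List Bool → List Bool
  | a :: r, b :: g => a :: (!b) :: interlace r g
  | _, _ => []

theorem flatten_ofFn_eq_interlace {N : ℕ} (r g : Fin N → Bool) :
    (List.ofFn fun i => [r i, !g i]).flatten = interlace (List.ofFn r) (List.ofFn g) := by
  induction N with
  | zero => simp [interlace]
  | succ N ih => simp [List.ofFn_succ, interlace, ih]

theorem sum_areaWordAux_interlace (r g : List Bool) (d : ℕ) (hlen : r.length = g.length)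
    (ht : d + r.count true = g.count true)
    (ha : ∀ i, (g.take i).count true ≤ d + (r.take i).count true) :
    ((areaWordAux (2 * d + 1) (interlace r g ++ [false])).map fun c => c / 2).sum +
      trueFalsePairs g = trueFalsePairs r + d * g.count false := by
  induction r generalizing g d with
  | nil =>
    obtain rfl : g = [] := List.length_eq_zero_iff.1 hlen.symm
    simp [interlace, areaWordAux, trueFalsePairs]
  | cons a r ih =>
    cases g with
    | nil => simp at hlen
    | cons b g =>
      have hl : r.length = g.length := by simpa using hlen
      have ha' : ∀ i, ((b :: g).take (i + 1)).count true ≤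
        d + ((a :: r).take (i + 1)).count true := fun i => ha _
      have c1 := List.count_true_add_count_false r
      have c2 := List.count_true_add_count_false g
      simp only [List.take_succ_cons, List.count_cons] at ha' ht
      cases a <;> cases b <;> simp at ha' ht
      · have := ih g d hl ht ha'
        have hd : 2 * d / 2 = d := by omega
        simp only [interlace, areaWordAux, trueFalsePairs, Bool.not_false, List.cons_append,
          List.map_cons, List.sum_cons, add_tsub_cancel_right, hd, List.count_cons_self]
        nlinarith
      · have h0 := ha' 0
        simp at h0
        obtain ⟨e, rfl⟩ := Nat.exists_eq_add_of_le' h0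
        have := ih g e hl (by omega) fun i => by have := ha' i; omega
        have hd : 2 * (e + 1) + 1 - 1 - 1 = 2 * e + 1 := by omega
        simp only [interlace, areaWordAux, trueFalsePairs, Bool.not_true, List.cons_append, hd]
        have h2 : (true :: g).count false = g.count false := by simp
        rw [h2]
        nlinarith
      · have := ih g (d + 1) hl (by omega) fun i => by have := ha' i; omega
        have hd : (2 * d + 1) / 2 = d := by omega
        have hd' : (2 * d + 1 + 1) / 2 = d + 1 := by omega
        rw [show 2 * (d + 1) + 1 = 2 * d + 1 + 1 + 1 by ring] at this
        simp only [interlace, areaWordAux, trueFalsePairs, Bool.not_false, List.cons_append,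
          List.map_cons, List.sum_cons, hd, hd', List.count_cons_self]
        have h2 : r.count false = g.count false + d + 1 := by omega
        nlinarith
      · have := ih g d hl (by omega) fun i => by have := ha' i; omega
        have hd : (2 * d + 1) / 2 = d := by omega
        simp only [interlace, areaWordAux, trueFalsePairs, Bool.not_true, List.cons_append,
          List.map_cons, List.sum_cons, hd, add_tsub_cancel_right]
        have h2 : (true :: g).count false = g.count false := by simp
        rw [h2]
        have h3 : r.count false = g.count false + d := by omega
        nlinarith

theorem RedPoly.count_take_le {m n : ℕ} (P : RedPoly m n) (i : ℕ) :
    ((List.ofFn P.green).take i).count true ≤ ((List.ofFn P.red).take i).count true := by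
  rcases Nat.lt_or_ge i (m + n) with hi | hi
  · cases i with
    | zero => simp
    | succ i =>
      have := P.green_le_red ⟨i, by omega⟩
      rw [count_take_ofFn, count_take_ofFn]
      simpa [Fin.le_def, Nat.lt_succ_iff] using this
  · rw [List.take_of_length_le (by simpa using hi), List.take_of_length_le (by simpa using hi),
      count_ofFn_eq_card, count_ofFn_eq_card, P.red_count, P.green_count]

theorem areaStat_add_trueFalsePairs {m n : ℕ} (P : RedPoly m n) :
    areaStat P + trueFalsePairs (List.ofFn P.green) = trueFalsePairs (List.ofFn P.red) := by
  have := sum_areaWordAux_interlace (List.ofFn P.red) (List.ofFn P.green) 0 (by simp)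
    (by rw [count_ofFn_eq_card, count_ofFn_eq_card, P.red_count, P.green_count, zero_add])
    (by simpa using P.count_take_le)
  rw [areaStat, areaWord, interlaced, areaWordAux, flatten_ofFn_eq_interlace]
  simpa using this

/-! ## Sums over decorations -/

theorem finsum_eq_finsum_sum {A B D M : Type*} [AddCommMonoid M] [Finite B] (p : A → B)
    (d : A → D) (S : B → Finset D) (hS : ∀ a, d a ∈ S (p a))
    (hi : ∀ a a', p a = p a' → d a = d a' → a = a')
    (hs : ∀ b, ∀ x ∈ S b, ∃ a, p a = b ∧ d a = x) (f : B → D → M) :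
    ∑ᶠ a, f (p a) (d a) = ∑ᶠ b, ∑ x ∈ S b, f b x := by
  have : Fintype B := Fintype.ofFinite B
  let e : A → Σ b : B, {x // x ∈ S b} := fun a => ⟨p a, d a, hS a⟩
  have he : Function.Bijective e := by
    constructor
    · intro a a' h
      have h1 : p a = p a' := congrArg Sigma.fst h
      refine hi a a' h1 ?_
      exact congrArg (fun z : Σ b : B, {x // x ∈ S b} => (z.2 : D)) h
    · rintro ⟨b, x, hx⟩
      obtain ⟨a, rfl, rfl⟩ := hs b x hx
      exact ⟨a, rfl⟩
  rw [finsum_eq_of_bijective (g := fun z : Σ b : B, {x // x ∈ S b} => f z.1 z.2) e he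
    fun _ => rfl, finsum_eq_sum_of_fintype, finsum_eq_sum_of_fintype, Fintype.sum_sigma]
  exact Fintype.sum_congr _ _ fun b => Finset.sum_coe_sort (S b) (f b)

/-- The `t`-enumerator of the ways to remove `k` of the summands `s` from `total`. -/
noncomputable def decorationSum (k total : ℕ) (s : Multiset ℕ) : MvPolynomial (Fin 2) ℤ :=
  ((s.powersetCard k).map fun u => Xt ^ (total - u.sum)).sum

theorem sum_powersetCard_eq_decorationSum {α : Type*} (S : Finset α) (v : α → ℕ) (k total : ℕ) :
    ∑ T ∈ S.powersetCard k, Xt ^ (total - ∑ i ∈ T, v i) =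
      decorationSum k total (S.val.map v) := by
  rw [decorationSum, Multiset.powersetCard_map, Multiset.map_map, Finset.sum,
    ← Finset.map_val_val_powersetCard, Multiset.map_map]
  rfl

/-- The contribution of a word to the two enumerators. -/
noncomputable def wordWeight (s k : ℕ) (w : List ℕ) : MvPolynomial (Fin 2) ℤ :=
  if w.count 0 + 1 = s then
    Xq ^ wordDinv w * decorationSum k (w.map (· / 2)).sum (riseValues 0 w) else 0

/-- The words encoding both families of objects. -/
abbrev CountedWord (m n : ℕ) : Type :=
  {w : List ℕ // Climbs 0 w ∧ w.countP (· % 2 = 0) = n ∧ w.countP (· % 2 = 1) = m}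

/-! ## Parking functions as words -/

theorem climbs_ofFn_iff {N : ℕ} (f : Fin N → ℕ) (x : ℕ) :
    Climbs x (List.ofFn f) ↔ ∀ j, f j ≤ (Fin.cons x f : Fin (N + 1) → ℕ) j.castSucc + 1 := by
  induction N generalizing x with
  | zero => simp [Climbs]
  | succ N ih =>
    have hc : ∀ j : Fin N, (Fin.cons x f : Fin (N + 2) → ℕ) j.succ.castSucc =
        (Fin.cons (f 0) (fun i => f i.succ) : Fin (N + 1) → ℕ) j.castSucc := by
      intro j
      rw [← Fin.succ_castSucc, Fin.cons_succ]
      exact congrFun (Fin.cons_self_tail f).symm _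
    rw [List.ofFn_succ, Climbs, ih, Fin.forall_fin_succ]
    simp only [hc, Fin.castSucc_zero, Fin.cons_zero]

namespace TwoCarsPF

variable {N : ℕ} (F : TwoCarsPF N)

/-- The letter of a step combines its area and its label, the label `2` coming first. -/
def letter (i : Fin N) : ℕ := 2 * F.a i + if F.l i = 1 then 1 else 0

theorem l_eq_one_or_two (i : Fin N) : F.l i = 1 ∨ F.l i = 2 := by
  have := F.l_one_le i
  have := F.l_le_two i
  omega

theorem letter_div_two (i : Fin N) : F.letter i / 2 = F.a i := by
  rw [letter]
  split_ifs <;> omega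

theorem letter_mod_two (i : Fin N) : F.letter i % 2 = 1 ↔ F.l i = 1 := by
  rw [letter]
  split_ifs with h <;> simp [h]

theorem letter_mod_two' (i : Fin N) : F.letter i % 2 = 0 ↔ F.l i = 2 := by
  have := F.letter_mod_two i
  have := F.l_eq_one_or_two i
  omega

theorem climbs_letter : Climbs 0 (List.ofFn F.letter) := by
  rw [climbs_ofFn_iff]
  intro j
  by_contra h
  by_cases hj : (j : ℕ) = 0
  · rw [show j.castSucc = 0 from Fin.ext hj, Fin.cons_zero] at h
    have := F.a_first j hj
    have := F.letter_div_two j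
    omega
  · obtain ⟨i, hi⟩ : ∃ i : Fin N, (i : ℕ) + 1 = j := ⟨⟨j - 1, by omega⟩, by simp only; omega⟩
    rw [show j.castSucc = i.succ from Fin.ext (by simp [hi]), Fin.cons_succ] at h
    have h1 := F.a_step i j hi
    have h2 := F.col_incr i j hi
    have h3 := F.l_eq_one_or_two i
    have h4 := F.l_eq_one_or_two j
    rw [letter, letter] at h
    split_ifs at h <;> omega

theorem letter_injective : Function.Injective (letter : TwoCarsPF N → Fin N → ℕ) := by
  intro F G h
  have ha : F.a = G.a := by
    funext i
    rw [← F.letter_div_two, ← G.letter_div_two, h]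
  have hl : F.l = G.l := by
    funext i
    have h1 := F.letter_mod_two i
    have h2 := G.letter_mod_two i
    have h3 := F.l_eq_one_or_two i
    have h4 := G.l_eq_one_or_two i
    rw [h] at h1
    omega
  cases F
  cases G
  simp_all

theorem exists_letter_eq {f : Fin N → ℕ} (h : Climbs 0 (List.ofFn f)) :
    ∃ F : TwoCarsPF N, F.letter = f := by
  rw [climbs_ofFn_iff] at h
  have hs : ∀ i j : Fin N, (i : ℕ) + 1 = j → f j ≤ f i + 1 := by
    intro i j hij
    have := h j
    rwa [show j.castSucc = i.succ from Fin.ext (by simp [hij]), Fin.cons_succ] at this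
  refine ⟨⟨fun i => f i / 2, fun i => 2 - f i % 2, ?_, ?_, ?_, ?_, ?_⟩, ?_⟩
  · intro i hi
    have := h i
    rw [show i.castSucc = 0 from Fin.ext hi, Fin.cons_zero] at this
    show f i / 2 = 0
    omega
  · intro i j hij
    have := hs i j hij
    show f j / 2 ≤ f i / 2 + 1
    omega
  · intro i j hij
    have := hs i j hij
    show f j / 2 = f i / 2 + 1 → 2 - f i % 2 < 2 - f j % 2
    omega
  · intro i
    show 1 ≤ 2 - f i % 2
    omega
  · intro i
    show 2 - f i % 2 ≤ 2
    omega
  · funext i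
    simp only [letter]
    split_ifs <;> omega

theorem isPFRise_iff (i : Fin N) : IsPFRise F i ↔
    (Fin.cons 0 F.letter : Fin (N + 1) → ℕ) i.castSucc % 2 = 1 ∧
      F.letter i = (Fin.cons 0 F.letter : Fin (N + 1) → ℕ) i.castSucc + 1 := by
  rw [cons_castSucc_eq_iff F.letter 0 i (fun x => x % 2 = 1 ∧ F.letter i = x + 1) (by simp),
    IsPFRise]
  refine exists_congr fun j => and_congr_right fun hj => ?_
  have h2 := F.col_incr j i hj
  have h3 := F.l_eq_one_or_two i
  have h4 := F.l_eq_one_or_two j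
  rw [F.letter_mod_two, letter, letter]
  split_ifs <;> omega

theorem pfDinv_eq : pfDinv F = wordDinv (List.ofFn F.letter) := by
  rw [pfDinv, ← card_filter_dinv]
  congr 1
  refine Finset.filter_congr fun p _ => and_congr_right fun _ => ?_
  have h3 := F.l_eq_one_or_two p.1
  have h4 := F.l_eq_one_or_two p.2
  rw [letter, letter]
  split_ifs <;> omega

theorem diagTwos_eq : diagTwos F = (List.ofFn F.letter).count 0 := by
  rw [diagTwos, count_ofFn_eq_card]
  congr 1
  refine Finset.filter_congr fun i _ => ?_
  have h3 := F.l_eq_one_or_two i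
  rw [letter]
  split_ifs <;> simp <;> omega

theorem sum_a_eq : ∑ i, F.a i = ((List.ofFn F.letter).map (· / 2)).sum := by
  rw [List.map_ofFn, List.sum_ofFn]
  exact Finset.sum_congr rfl fun i _ => (F.letter_div_two i).symm

open Classical in
theorem map_a_rises : (univ.filter (IsPFRise F)).val.map F.a =
    (riseValues 0 (List.ofFn F.letter) : Multiset ℕ) := by
  ext a
  rw [Multiset.count_map, Multiset.coe_count, ← card_filter_rise, ← Finset.filter_val,
    Finset.card_val, Finset.filter_filter]
  congr 1
  refine Finset.filter_congr fun i _ => ?_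
  rw [F.isPFRise_iff, F.letter_div_two]

end TwoCarsPF

theorem Tstar_eq_finsum (m n s k : ℕ) [Finite (CountedWord m n)] :
    Tstar n m s k = ∑ᶠ w : CountedWord m n, wordWeight s k w := by
  classical
  let B := {F : TwoCarsPF (n + m) // (univ.filter fun i => F.l i = 1).card = m ∧
    (univ.filter fun i => F.l i = 2).card = n}
  let e : B → CountedWord m n := fun F => ⟨List.ofFn F.1.letter, F.1.climbs_letter, by
    rw [countP_ofFn_eq_card]
    simpa [F.1.letter_mod_two'] using F.2.2, by
    rw [countP_ofFn_eq_card]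
    simpa [F.1.letter_mod_two] using F.2.1⟩
  have he : Function.Bijective e := by
    constructor
    · intro F G h
      exact Subtype.ext (TwoCarsPF.letter_injective (List.ofFn_injective (congrArg Subtype.val h)))
    · rintro ⟨w, hw, h0, h1⟩
      have hlen : w.length = n + m := by
        have := w.length_eq_countP_add_countP (· % 2 = 0)
        simp only [decide_eq_true_eq] at this
        rw [this, h0, ← h1]
        congr 2
        funext x
        simp
      obtain ⟨f, rfl⟩ : ∃ f : Fin (n + m) → ℕ, w = List.ofFn f := by
        subst_vars
        exact ⟨fun i => w.get (i.cast hlen.symm), by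
          apply List.ext_get <;> simp [hlen]⟩
      obtain ⟨F, rfl⟩ := TwoCarsPF.exists_letter_eq hw
      refine ⟨⟨F, ?_, ?_⟩, rfl⟩
      · rw [countP_ofFn_eq_card] at h1
        simpa [F.letter_mod_two] using h1
      · rw [countP_ofFn_eq_card] at h0
        simpa [F.letter_mod_two'] using h0
  have : Finite B := Finite.of_injective e he.1
  rw [← finsum_eq_of_bijective (f := fun F : B => wordWeight s k (e F).1) e he fun _ => rfl]
  rw [Tstar]
  let f : B → Finset (Fin (n + m)) → MvPolynomial (Fin 2) ℤ := fun F T =>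
    if diagTwos F.1 + 1 = s then
      Xq ^ pfDinv F.1 * Xt ^ ((∑ i, F.1.a i) - ∑ i ∈ T, F.1.a i) else 0
  have key := finsum_eq_finsum_sum (A := DecTwoCarsPF n m k) (B := B)
    (fun Q => ⟨Q.pf, Q.ones_count, Q.twos_count⟩) (fun Q => Q.marks)
    (fun F => (univ.filter (IsPFRise F.1)).powersetCard k)
    (fun Q => by
      rw [Finset.mem_powersetCard]
      exact ⟨fun i hi => by simpa using Q.marks_rise i hi, Q.marks_card⟩)
    (by
      rintro ⟨⟩ ⟨⟩ h1 h2
      have := congrArg Subtype.val h1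
      simp_all)
    (by
      rintro ⟨F, h1, h2⟩ T hT
      rw [Finset.mem_powersetCard] at hT
      exact ⟨⟨F, h1, h2, T, hT.2, fun i hi => by simpa using hT.1 hi⟩, rfl, rfl⟩) f
  refine (finsum_congr fun Q => ?_).trans (key.trans (finsum_congr fun F => ?_))
  · have : pfUArea Q = (∑ i, Q.pf.a i) - ∑ i ∈ Q.marks, Q.pf.a i := by
      rw [pfUArea, ← Finset.sum_sdiff (Finset.subset_univ Q.marks), Nat.add_sub_cancel]
    rw [this]
  · simp only [f, e, wordWeight, ← TwoCarsPF.diagTwos_eq]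
    split_ifs
    · rw [← Finset.mul_sum, sum_powersetCard_eq_decorationSum, TwoCarsPF.map_a_rises,
        TwoCarsPF.pfDinv_eq, TwoCarsPF.sum_a_eq]
    · simp

/-! ## Reduced polyominoes as words -/

theorem CountedWord.le_of_mem {m n : ℕ} (w : CountedWord m n) :
    ∀ x ∈ w.1, x ≤ m + n := by
  obtain ⟨w, hw, h0, h1⟩ := w
  intro x hx
  have h := hw.lt_length x hx
  have := w.length_eq_countP_add_countP (· % 2 = 0)
  have h2 : w.countP (fun x => ¬ decide (decide (x % 2 = 0) = true)) =
      w.countP (· % 2 = 1) := by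
    congr 1
    funext x
    simp
  simp only [decide_eq_true_eq] at this h2
  omega

theorem exists_redPoly {m n : ℕ} {r g : List Bool} (hrt : r.count true = n)
    (hrf : r.count false = m) (hgt : g.count true = n) (hgf : g.count false = m)
    (h : ∀ i, (g.take i).count true ≤ (r.take i).count true) :
    ∃ P : RedPoly m n, List.ofFn P.red = r ∧ List.ofFn P.green = g := by
  have key : ∀ l : List Bool, l.count true = n → l.count false = m →
      ∃ f : Fin (m + n) → Bool, l = List.ofFn f := by
    intro l ht hf
    have hlen : l.length = m + n := by
      rw [← List.count_true_add_count_false l]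
      omega
    exact ⟨fun i => l.get (i.cast hlen.symm), by apply List.ext_get <;> simp [hlen]⟩
  obtain ⟨r, rfl⟩ := key r hrt hrf
  obtain ⟨g, rfl⟩ := key g hgt hgf
  rw [count_ofFn_eq_card] at hrt hgt
  refine ⟨⟨r, g, hrt, hgt, fun i => ?_⟩, rfl, rfl⟩
  have hi := h ((i : ℕ) + 1)
  rw [count_take_ofFn, count_take_ofFn] at hi
  simp only [Nat.lt_succ_iff] at hi
  exact hi

/-- The layers of a word of length `m + n`, followed by enough empty layers. -/
def CountedWord.ladder {m n : ℕ} (w : CountedWord m n) : List (List Bool) :=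
  layers (2 * (m + n) + 1) 0 w.1

namespace CountedWord

variable {m n : ℕ} (w : CountedWord m n)

theorem lt_of_mem : ∀ x ∈ w.1, x < 0 + (2 * (m + n) + 1) := by
  intro x hx
  have := CountedWord.le_of_mem w x hx
  omega

theorem isLadder_ladder : IsLadder w.ladder :=
  isLadder_layers w.2.1 _ _ w.lt_of_mem

theorem count_weave_ladder :
    (weave w.ladder).count true = n ∧ (weave w.ladder).count false = m := by
  have := count_weave_layers w.1 _ 0 w.lt_of_mem
  rw [ladder, this.1, this.2]
  constructor
  · simpa using w.2.2.1
  · refine Eq.trans ?_ w.2.2.2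
    refine List.countP_congr fun x _ => ?_
    simp
    omega

theorem exists_poly : ∃ P : RedPoly m n,
    List.ofFn P.red = upperPath w.ladder ∧ List.ofFn P.green = weave w.ladder := by
  have h := w.isLadder_ladder
  have hc := w.count_weave_ladder
  have hc' := h.count_weave
  refine exists_redPoly ?_ ?_ hc.1 hc.2 ?_
  · rw [upperPath, List.count_append, count_true_map_not, List.count_replicate_self]
    omega
  · rw [upperPath, List.count_append, count_false_map_not]
    simp [List.count_replicate]
    omega
  · intro i
    set v := (w.ladder.headD []).count true with hv
    rcases Nat.le_total i v with hi | hi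
    · rw [upperPath, ← hv, List.take_append_of_le_length (by simpa using hi), List.take_replicate,
        List.count_replicate_self, min_eq_left hi]
      exact List.count_le_length.trans (List.length_take_le _ _)
    · obtain ⟨j, rfl⟩ := Nat.exists_eq_add_of_le' hi
      have := h.staysAbove j
      rw [← hv] at this
      rw [upperPath, ← hv, List.take_append, List.count_append]
      simpa [List.take_replicate] using this

/-- The polyomino encoded by a word. -/
noncomputable def poly : RedPoly m n := w.exists_poly.choose

theorem ofFn_red : List.ofFn w.poly.red = upperPath w.ladder := w.exists_poly.choose_spec.1

theorem ofFn_green : List.ofFn w.poly.green = weave w.ladder := w.exists_poly.choose_spec.2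

theorem upperPath_eq_iff {C C' : List (List Bool)} (h : IsLadder C) (h' : IsLadder C') :
    upperPath C = upperPath C' ↔
      (C.headD []).count true = (C'.headD []).count true ∧ weave C.tail = weave C'.tail := by
  constructor
  · intro he
    have hh : ∀ {C : List (List Bool)}, IsLadder C →
        listHeight (upperPath C) 0 = (C.headD []).count true := by
      intro C hC
      rw [upperPath, listHeight_replicate_append,
        listHeight_zero (head?_map_not hC.head?_weave_tail), add_zero]
    have hv := (hh h).symm.trans ((congrArg (listHeight · 0) he).trans (hh h'))
    refine ⟨hv, ?_⟩
    rw [upperPath, upperPath, hv] at he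
    rw [← map_not_map_not (weave C.tail), List.append_cancel_left he, map_not_map_not]
  · rintro ⟨h1, h2⟩
    rw [upperPath, upperPath, h1, h2]

theorem poly_injective : Function.Injective (poly : CountedWord m n → RedPoly m n) := by
  intro w w' h
  have hr := w.ofFn_red
  rw [h, w'.ofFn_red, upperPath_eq_iff w'.isLadder_ladder w.isLadder_ladder] at hr
  have hg := w.ofFn_green
  rw [h, w'.ofFn_green] at hg
  have hl : w.ladder = w'.ladder := w.isLadder_ladder.eq_of_weave_eq w'.isLadder_ladder
    (by simp [ladder, length_layers]) hr.1.symm hg.symm hr.2.symm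
  refine Subtype.ext (w.2.1.eq_of_layer_eq w'.2.1 fun i => ?_)
  rcases Nat.lt_or_ge i (2 * (m + n) + 1) with hi | hi
  · simpa using layer_eq_of_layers_eq hl hi
  · rw [layer_eq_nil, layer_eq_nil]
    · intro x hx
      have := w'.lt_of_mem x hx
      omega
    · intro x hx
      have := w.lt_of_mem x hx
      omega

theorem _root_.exists_eq_replicate_append (r : List Bool) :
    ∃ v p, r = List.replicate v true ++ p ∧ p.head? ≠ some true := by
  induction r with
  | nil => exact ⟨0, [], rfl, by simp⟩
  | cons b r ih =>
    cases b with
    | false => exact ⟨0, false :: r, rfl, by simp⟩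
    | true =>
      obtain ⟨v, p, rfl, hp⟩ := ih
      exact ⟨v + 1, p, rfl, hp⟩

theorem poly_surjective : Function.Surjective (poly : CountedWord m n → RedPoly m n) := by
  intro P
  obtain ⟨v, p, hr, hp⟩ := exists_eq_replicate_append (List.ofFn P.red)
  set q := List.ofFn P.green with hq
  have hqt : q.count true = n := by rw [hq, count_ofFn_eq_card, P.green_count]
  have hrt : (List.ofFn P.red).count true = n := by rw [count_ofFn_eq_card, P.red_count]
  have hql : q.length = m + n := by simp [hq]
  have hrl : (List.ofFn P.red).length = m + n := by simp
  have hqc := List.count_true_add_count_false q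
  have hpc := List.count_true_add_count_false p
  have hpt : v + p.count true = n := by
    rw [← hrt, hr, List.count_append, List.count_replicate_self]
  have hpl : v + p.length = m + n := by
    rw [← hrl, hr, List.length_append, List.length_replicate]
  obtain ⟨C, hlen, hC, hv, h0, h1⟩ := exists_ladder (2 * (m + n) + 1) p q (by omega) v
    (by omega) (by omega) hp fun i => by
      have := P.count_take_le (i + v)
      rw [hr, ← hq, List.take_append, List.count_append] at this
      simpa [List.take_replicate] using this
  obtain ⟨w, hw, hlt, hl⟩ := hC.exists_word
  rw [hlen] at hlt hl
  have hc := count_weave_layers w _ 0 (by simpa only [zero_add] using hlt)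
  rw [hl, h0] at hc
  have hup : List.ofFn P.red = upperPath C := by rw [upperPath, hv, h1, hr]
  obtain ⟨w', rfl⟩ : ∃ w' : CountedWord m n, w'.1 = w := by
    refine ⟨⟨w, hw, ?_, ?_⟩, rfl⟩
    · rw [← hqt, hc.1]
      simp
    · rw [show m = q.count false by omega, hc.2]
      refine List.countP_congr fun x _ => ?_
      simp
      omega
  have hl' : w'.ladder = C := hl
  refine ⟨w', ?_⟩
  have e1 := List.ofFn_injective (w'.ofFn_red.trans ((congrArg upperPath hl').trans hup.symm))
  have e2 := List.ofFn_injective (w'.ofFn_green.trans ((congrArg weave hl').trans (h0.trans hq)))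
  generalize w'.poly = Q at e1 e2
  cases P
  cases Q
  simp_all

theorem poly_bijective : Function.Bijective (poly : CountedWord m n → RedPoly m n) :=
  ⟨poly_injective, poly_surjective⟩

end CountedWord

theorem sum_card_filter_le (n M : ℕ) (Y : ℕ → ℕ) :
    ∑ y ∈ range n, ((range M).filter fun k => Y k ≤ y).card = ∑ k ∈ range M, (n - Y k) := by
  simp only [Finset.card_filter]
  rw [Finset.sum_comm]
  refine Finset.sum_congr rfl fun k _ => ?_
  rw [← Finset.card_filter, ← Nat.card_Ico]
  congr 1
  ext y
  simp
  tauto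

theorem truesBefore_lt {N : ℕ} {f : Fin N → Bool} {i j : Fin N} (hi : f i = true) (h : i < j) :
    truesBefore f i < truesBefore f j := by
  apply Finset.card_lt_card
  rw [Finset.ssubset_iff_of_subset]
  · exact ⟨i, by simp [hi, h], by simp⟩
  · intro l
    simp only [mem_filter, mem_univ, true_and]
    exact fun hl => ⟨hl.1.trans h, hl.2⟩

theorem truesBefore_lt_card {N : ℕ} {f : Fin N → Bool} {i : Fin N} (hi : f i = true) :
    truesBefore f i < (univ.filter fun j => f j = true).card := by
  apply Finset.card_lt_card
  rw [Finset.ssubset_iff_of_subset]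
  · exact ⟨i, by simp [hi], by simp⟩
  · intro l
    simp only [mem_filter, mem_univ, true_and]
    exact And.right

theorem uBounce_eq {m n k : ℕ} (Q : ValleyDecorated m n k) :
    uBounce Q = bounceStat Q.poly - ∑ j ∈ Q.marks, vertLabel Q.poly (rowOf Q.poly j) := by
  have hi : Set.InjOn (rowOf Q.poly) Q.marks := by
    intro i hi j hj h
    have h1 := (Q.marks_valley i hi).1
    have h2 := (Q.marks_valley j hj).1
    rcases lt_trichotomy i j with hij | hij | hij
    · exact absurd h (truesBefore_lt h1 hij).ne
    · exact hij
    · exact absurd h (truesBefore_lt h2 hij).ne'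
  have hs : Q.marks.image (rowOf Q.poly) ⊆ range n := by
    intro y hy
    obtain ⟨j, hj, rfl⟩ := Finset.mem_image.1 hy
    have := truesBefore_lt_card (Q.marks_valley j hj).1
    rw [Q.poly.red_count] at this
    exact Finset.mem_range.2 this
  have := Finset.sum_sdiff (f := vertLabel Q.poly) hs
  rw [Finset.sum_image hi] at this
  rw [uBounce, bounceStat]
  omega

theorem isRedValley_iff {m n : ℕ} (P : RedPoly m n) (j : Fin (m + n)) :
    IsRedValley P j ↔ P.red j = true ∧
      (Fin.cons true P.red : Fin (m + n + 1) → Bool) j.castSucc = false := by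
  rw [cons_castSucc_eq_iff P.red true j (· = false) (by simp), IsRedValley]

open Classical in
theorem map_vertLabel_valleys {m n : ℕ} (P : RedPoly m n) :
    (univ.filter (IsRedValley P)).val.map (fun j => vertLabel P (rowOf P j)) =
      (valleyLabels (vertLabel P) true 0 (List.ofFn P.red) : Multiset ℕ) := by
  ext a
  rw [Multiset.count_map, Multiset.coe_count, ← card_filter_valley, ← Finset.filter_val,
    Finset.card_val, Finset.filter_filter]
  congr 1
  refine Finset.filter_congr fun i _ => ?_
  rw [isRedValley_iff, zero_add, rowOf]

theorem sum_div_two_eq (w : List ℕ) :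
    (w.map (· / 2)).sum = ((w.filter fun x => x % 2 = 0).map (· / 2)).sum +
      ((w.filter fun x => x % 2 = 1).map (· / 2)).sum := by
  induction w with
  | nil => simp
  | cons x w ih =>
    rcases Nat.mod_two_eq_zero_or_one x with h | h
    · simp [h, ih, add_assoc]
    · simp [h, ih]
      omega

theorem valleyLabels_replicate_append (L : ℕ → ℕ) (v y : ℕ) (l : List Bool) :
    valleyLabels L true y (List.replicate v true ++ l) = valleyLabels L true (y + v) l := by
  induction v generalizing y with
  | zero => rfl
  | succ v ih =>
    rw [List.replicate_succ, List.cons_append, valleyLabels, ih]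
    simp [add_assoc, add_comm 1]

namespace CountedWord

variable {m n : ℕ} (w : CountedWord m n)

theorem bouncePt_poly (k : ℕ) :
    bouncePt w.poly k = (w.1.countP (fun x => x % 2 = 1 ∧ x < 2 * k),
      w.1.countP (fun x => x % 2 = 0 ∧ x < 2 * k)) := by
  rw [bouncePt_eq_listBounce, w.ofFn_red, w.ofFn_green, ladder,
    listBounce_layers w.2.1 _ _ w.lt_of_mem]
  congr 1 <;> refine List.countP_congr fun x _ => ?_
  · simp
    omega
  · simp

theorem vertLabel_poly {k y : ℕ} (hk : k ≤ m + n)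
    (h : w.1.countP (fun x => x % 2 = 0 ∧ x < 2 * k) ≤ y)
    (h' : y < w.1.countP (fun x => x % 2 = 0 ∧ x < 2 * (k + 1))) :
    vertLabel w.poly y = k := by
  have hmono : ∀ i j, i ≤ j → w.1.countP (fun x => x % 2 = 0 ∧ x < 2 * i) ≤
      w.1.countP (fun x => x % 2 = 0 ∧ x < 2 * j) := by
    intro i j hij
    refine List.countP_mono_left fun x _ => ?_
    simp only [decide_eq_true_eq]
    omega
  rw [vertLabel]
  simp only [bouncePt_poly]
  convert Finset.card_range k using 2
  ext j
  simp only [mem_filter, mem_range]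
  constructor
  · rintro ⟨-, hj⟩
    by_contra! hkj
    have := hmono (k + 1) (j + 1) (by omega)
    omega
  · intro hj
    exact ⟨by omega, (hmono (j + 1) k hj).trans h⟩

theorem sum_even_sub (c : ℕ) :
    ∑ k ∈ range (m + n), (w.1.countP (fun x => x % 2 = c) -
      w.1.countP (fun x => x % 2 = c ∧ x < 2 * (k + 1))) =
      ((w.1.filter fun x => x % 2 = c).map (· / 2)).sum := by
  rw [← sum_countP_even w.1 c (m + n) fun x hx => by have := w.le_of_mem x hx; omega]
  refine Finset.sum_congr rfl fun k _ => ?_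
  have : ∀ l : List ℕ, l.countP (fun x => x % 2 = c) =
      l.countP (fun x => x % 2 = c ∧ x < 2 * (k + 1)) +
        l.countP (fun x => x % 2 = c ∧ 2 * (k + 1) ≤ x) := by
    intro l
    induction l with
    | nil => rfl
    | cons x l ih =>
      simp only [List.countP_cons, decide_eq_true_eq]
      split_ifs <;> omega
  rw [this, Nat.add_sub_cancel_left]

theorem bounceStat_poly : bounceStat w.poly = (w.1.map (· / 2)).sum := by
  rw [bounceStat]
  simp only [vertLabel, horLabel, bouncePt_poly]
  rw [sum_card_filter_le, sum_card_filter_le, sum_div_two_eq, ← w.sum_even_sub, ← w.sum_even_sub,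
    w.2.2.1, w.2.2.2]

theorem zeroLabelCount_poly (h : 0 < m + n) : zeroLabelCount w.poly = w.1.count 0 := by
  have hc : w.1.countP (fun x => x % 2 = 0 ∧ x < 2 * (0 + 1)) = w.1.count 0 := by
    rw [List.count_eq_countP]
    refine List.countP_congr fun x _ => ?_
    simp
    omega
  have hle : w.1.count 0 ≤ n := by
    have := w.2.2.1
    rw [← hc]
    refine (List.countP_mono_left fun x _ => ?_).trans this.le
    simp only [decide_eq_true_eq]
    exact And.left
  rw [zeroLabelCount]
  convert Finset.card_range (w.1.count 0) using 2
  ext y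
  simp only [mem_filter, mem_range]
  constructor
  · rintro ⟨-, hy⟩
    rw [vertLabel, Finset.card_eq_zero, Finset.filter_eq_empty_iff] at hy
    have := hy (Finset.mem_range.2 h)
    rw [bouncePt_poly] at this
    simp only [hc] at this
    omega
  · intro hy
    exact ⟨by omega, w.vertLabel_poly (Nat.zero_le _) (by simp) (by omega)⟩

theorem areaStat_poly : areaStat w.poly = wordDinv w.1 := by
  have h1 := areaStat_add_trueFalsePairs w.poly
  rw [w.ofFn_red, w.ofFn_green, upperPath, trueFalsePairs_replicate_append, count_false_map_not,
    trueFalsePairs_map_not, w.isLadder_ladder.pairs_weave] at h1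
  have h2 := sum_falseTruePairs_layers w.1 (2 * (m + n) + 1) 0
  simp only [zero_add] at h2
  rw [sum_falseTruePairs_layer w.1 _ (by simpa only [zero_add] using w.lt_of_mem)] at h2
  rw [ladder] at h1
  omega

theorem valleyLabels_poly :
    (valleyLabels (vertLabel w.poly) true 0 (List.ofFn w.poly.red) : Multiset ℕ) =
      (riseValues 0 w.1 : Multiset ℕ) := by
  ext a
  rw [Multiset.coe_count, Multiset.coe_count, w.ofFn_red, upperPath, valleyLabels_replicate_append]
  have hv : 0 + (w.ladder.headD []).count true =
      w.1.countP fun x => x % 2 = 0 ∧ x < 2 * (0 + 1) := by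
    rw [zero_add, ladder, layers, List.headD_cons, count_true_layer, List.count_eq_countP]
    refine List.countP_congr fun x _ => ?_
    simp
    omega
  rw [hv, ladder, layers, List.tail_cons]
  refine (count_valleyLabels_weave w.2.1 _ (m + n)
    (fun x hx => by have := w.le_of_mem x hx; omega)
    (fun k y hk h h' => w.vertLabel_poly hk h h') (2 * (m + n)) 0 true
    (fun x hx => by have := w.le_of_mem x hx; omega) a).trans ?_
  cases a with
  | zero => rw [if_neg (lt_irrefl 0), List.count_eq_zero_of_not_mem (zero_notMem_riseValues _ _)]
  | succ a =>
    rw [if_pos (Nat.succ_pos a), w.2.1.count_riseValues]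
    rw [show 2 * (a + 1) - 1 = 2 * a + 1 by omega]
    simp

end CountedWord

instance (m n : ℕ) : Finite (RedPoly m n) :=
  Finite.of_injective (fun P => (P.red, P.green)) fun P Q h => by
    cases P
    cases Q
    simp_all

instance (m n : ℕ) : Finite (CountedWord m n) :=
  Finite.of_injective _ CountedWord.poly_injective

theorem RPbullet_eq_finsum (m n s k : ℕ) (h : 0 < m + n) :
    RPbullet m n s k = ∑ᶠ w : CountedWord m n, wordWeight s k w := by
  classical
  let f : RedPoly m n → Finset (Fin (m + n)) → MvPolynomial (Fin 2) ℤ := fun P T =>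
    if zeroLabelCount P + 1 = s then
      Xq ^ areaStat P * Xt ^ (bounceStat P - ∑ j ∈ T, vertLabel P (rowOf P j)) else 0
  have key := finsum_eq_finsum_sum (A := ValleyDecorated m n k) (fun Q => Q.poly)
    (fun Q => Q.marks) (fun P => (univ.filter (IsRedValley P)).powersetCard k)
    (fun Q => by
      rw [Finset.mem_powersetCard]
      exact ⟨fun i hi => by simpa using Q.marks_valley i hi, Q.marks_card⟩)
    (by
      rintro ⟨⟩ ⟨⟩ h1 h2
      simp_all)
    (by
      intro P T hT
      rw [Finset.mem_powersetCard] at hT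
      exact ⟨⟨P, T, hT.2, fun i hi => by simpa using hT.1 hi⟩, rfl, rfl⟩) f
  rw [RPbullet]
  refine (finsum_congr fun Q => ?_).trans (key.trans (Eq.symm ?_))
  · rw [uBounce_eq]
  · refine finsum_eq_of_bijective _ CountedWord.poly_bijective fun w => ?_
    simp only [f, wordWeight, w.zeroLabelCount_poly h]
    split_ifs
    · rw [← Finset.mul_sum, sum_powersetCard_eq_decorationSum, map_vertLabel_valleys,
        w.valleyLabels_poly, w.areaStat_poly, w.bounceStat_poly]
    · simp

theorem stmt10 (m n k s : ℕ) (hm : 1 ≤ m) (hn : 1 ≤ n) (hs : 1 ≤ s) (hsn : s ≤ n + 1) :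
    Tstar n m s k = RPbullet m n s k := by
  rw [Tstar_eq_finsum, RPbullet_eq_finsum m n s k (by omega)]
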